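/- arXiv:math/0605642 — 2 statements merged into one kernel-verified Lean document; each statement's English description precedes it below -/
import Mathlib

section
/- Consider the random graph G(n, m) with m = m(n) edges, where λ_n := 2m/n → λ for some λ > 0, and for k ≥ 0 let N_k = N_k(n) be the number of vertices of degree k. Let (a_k)_{k=0}^∞ be a sequence of real numbers with a_k = O(A^k) for some A < ∞. Then n^{-1/2}(Σ_k a_k N_k − n Σ_k a_k π_{λ_n}(k)) converges in distribution to a normal random variable with mean 0 and variance Σ_{j,k} a_j a_k σ̃_{jk}, where σ̃_{jk} := π_λ(j) π_λ(k) (−(j−λ)(k−λ)/λ − 1) + π_λ(k) δ_{jk}. -/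
open MeasureTheory ProbabilityTheory Filter Topology

noncomputable section

/-- Convergence in distribution (weak convergence of laws): integrals of every bounded
continuous function converge. -/
def TendstoInDistribution {E : Type*} [MeasurableSpace E] [TopologicalSpace E]
    (μs : ℕ → Measure E) (μ : Measure E) : Prop :=
  ∀ f : BoundedContinuousFunction E ℝ,
    Tendsto (fun n => ∫ x, f x ∂(μs n)) atTop (𝓝 (∫ x, f x ∂μ))

/-- `κ` is a version of the conditional distribution of the first coordinate given the
second coordinate, for the joint law `μ`: it is a Markov kernel which disintegrates `μ`. -/
def IsCondLaw {E F : Type*} [MeasurableSpace E] [MeasurableSpace F]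
    (μ : Measure (E × F)) (κ : Kernel F E) : Prop :=
  IsMarkovKernel κ ∧
  ∀ s : Set E, ∀ t : Set F, MeasurableSet s → MeasurableSet t →
    μ (s ×ˢ t) = ∫⁻ z in t, κ z s ∂(μ.map Prod.snd)

/-- A family of measures `κ z` (conditional distributions) is stochastically increasing:
`P(X ≤ x | Y = z)` is weakly decreasing in `z`. -/
def StochIncrFam {E F : Type*} [MeasurableSpace E] [Preorder E] [Preorder F]
    (κ : F → Measure E) : Prop :=
  ∀ z₁ z₂ : F, z₁ ≤ z₂ → ∀ x : E, κ z₂ {w | w ≤ x} ≤ κ z₁ {w | w ≤ x}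

/-- A family of measures `κ z` is stochastically decreasing: `P(X ≥ x | Y = z)` is weakly
decreasing in `z` (equivalently, `-X` is stochastically increasing). -/
def StochDecrFam {E F : Type*} [MeasurableSpace E] [Preorder E] [Preorder F]
    (κ : F → Measure E) : Prop :=
  ∀ z₁ z₂ : F, z₁ ≤ z₂ → ∀ x : E, κ z₂ {w | x ≤ w} ≤ κ z₁ {w | x ≤ w}

/-- Covariance of two real functionals under a measure. -/
def covFn {E : Type*} [MeasurableSpace E] (μ : Measure E) (f g : E → ℝ) : ℝ :=
  ∫ x, f x * g x ∂μ - (∫ x, f x ∂μ) * (∫ x, g x ∂μ)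

/-- A measure on a real normed space is Gaussian (jointly normal, possibly degenerate) if
every continuous linear functional pushes it forward to a one-dimensional Gaussian law. -/
def IsGaussianMeasure {E : Type*} [NormedAddCommGroup E] [NormedSpace ℝ E]
    [MeasurableSpace E] (μ : Measure E) : Prop :=
  ∀ L : E →L[ℝ] ℝ, ∃ m : ℝ, ∃ v : NNReal, μ.map (fun x => L x) = gaussianReal m v

open scoped ENNReal

/-- The index type for potential edges of a graph on `Fin n`: unordered pairs of distinct
vertices. -/
abbrev EdgeIdx (n : ℕ) := {e : Sym2 (Fin n) // ¬ e.IsDiag}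

/-- The Erdős–Rényi measure `G(n,p)`: each potential edge is present independently with
probability `p`; a graph is encoded as its edge indicator `S : EdgeIdx n → Bool`. -/
def gnpMeasure (n : ℕ) (p : ℝ) : Measure (EdgeIdx n → Bool) :=
  ∑ S : EdgeIdx n → Bool,
    (∏ e : EdgeIdx n, if S e then ENNReal.ofReal p else ENNReal.ofReal (1 - p)) •
      Measure.dirac S

/-- The number of edges of the graph `S`. -/
def edgeCount (n : ℕ) (S : EdgeIdx n → Bool) : ℕ :=
  (Finset.univ.filter fun e : EdgeIdx n => S e = true).card

/-- The uniform measure `G(n,m)` on graphs on `Fin n` with exactly `m` edges. -/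
def gnmMeasure (n m : ℕ) : Measure (EdgeIdx n → Bool) :=
  ∑ S : EdgeIdx n → Bool,
    (if edgeCount n S = m then
        ((Finset.univ.filter fun S' : EdgeIdx n → Bool => edgeCount n S' = m).card :
          ℝ≥0∞)⁻¹
      else 0) • Measure.dirac S

/-- The degree of the vertex `v` in the graph `S`. -/
def degree (n : ℕ) (S : EdgeIdx n → Bool) (v : Fin n) : ℕ :=
  (Finset.univ.filter fun e : EdgeIdx n => S e = true ∧ v ∈ (e : Sym2 (Fin n))).card

/-- The number of vertices of degree `k` in the graph `S`. -/
def degCount (n : ℕ) (k : ℕ) (S : EdgeIdx n → Bool) : ℕ :=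
  (Finset.univ.filter fun v : Fin n => degree n S v = k).card

/-- The Poisson point probabilities `π_λ(k) = e^{-λ} λ^k / k!`. -/
def poissonProb (lam : ℝ) (k : ℕ) : ℝ :=
  Real.exp (-lam) * lam ^ k / (k.factorial : ℝ)

namespace GnmCLT

open Finset

/-- Degree of `v` in the graph with edge set `G`. -/
def dg {n : ℕ} (G : Finset (EdgeIdx n)) (v : Fin n) : ℕ :=
  (G.filter fun e : EdgeIdx n => v ∈ (e : Sym2 (Fin n))).card

/-- The vertex statistic `Σ_v p(d_v)`. -/
def vs {n : ℕ} (p : ℕ → ℝ) (G : Finset (EdgeIdx n)) : ℝ := ∑ v : Fin n, p (dg G v)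

/-- The sum of `p(d_v)` over the two endpoints `v` of `e`. -/
def es {n : ℕ} (p : ℕ → ℝ) (G : Finset (EdgeIdx n)) (e : EdgeIdx n) : ℝ :=
  ∑ v : Fin n, if v ∈ (e : Sym2 (Fin n)) then p (dg G v) else 0

/-- Forward difference. -/
def fd (p : ℕ → ℝ) (k : ℕ) : ℝ := p (k + 1) - p k

/-- Shift. -/
def sh (p : ℕ → ℝ) (k : ℕ) : ℝ := p (k + 1)

/-- Expectation over the uniform graph with `m` edges. -/
def Ex {E : Type*} [AddCommGroup E] [Module ℝ E] (n m : ℕ) (F : Finset (EdgeIdx n) → E) : E :=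
  ((Fintype.card (EdgeIdx n)).choose m : ℝ)⁻¹ •
    ∑ G ∈ powersetCard m (univ : Finset (EdgeIdx n)), F G

section basic
variable {E : Type*} [NormedAddCommGroup E] [NormedSpace ℝ E] {n m : ℕ}

lemma Ex_add (F F' : Finset (EdgeIdx n) → E) :
    Ex n m (fun G => F G + F' G) = Ex n m F + Ex n m F' := by
  simp [Ex, sum_add_distrib, smul_add]

lemma Ex_sub (F F' : Finset (EdgeIdx n) → E) :
    Ex n m (fun G => F G - F' G) = Ex n m F - Ex n m F' := by
  simp [Ex, sum_sub_distrib, smul_sub]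

lemma Ex_smul (c : ℝ) (F : Finset (EdgeIdx n) → E) :
    Ex n m (fun G => c • F G) = c • Ex n m F := by
  simp only [Ex, ← smul_sum]
  rw [smul_comm]

lemma Ex_mul (c : ℝ) (F : Finset (EdgeIdx n) → ℝ) :
    Ex n m (fun G => c * F G) = c * Ex n m F := by
  simpa using Ex_smul c F

lemma Ex_cmul (c : ℂ) (F : Finset (EdgeIdx n) → ℂ) :
    Ex n m (fun G => c * F G) = c * Ex n m F := by
  simp only [Ex, ← mul_sum]
  rw [mul_smul_comm]

lemma Ex_congr {F F' : Finset (EdgeIdx n) → E} (h : ∀ G, G.card = m → F G = F' G) :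
    Ex n m F = Ex n m F' := by
  unfold Ex
  congr 1
  exact sum_congr rfl fun G hG => h G (mem_powersetCard.1 hG).2

lemma Ex_mono {F F' : Finset (EdgeIdx n) → ℝ} (h : ∀ G, G.card = m → F G ≤ F' G) :
    Ex n m F ≤ Ex n m F' := by
  unfold Ex
  simp only [smul_eq_mul]
  gcongr with G hG
  exact h G (mem_powersetCard.1 hG).2

lemma norm_Ex_le (F : Finset (EdgeIdx n) → E) :
    ‖Ex n m F‖ ≤ Ex n m (fun G => ‖F G‖) := by
  unfold Ex
  rw [norm_smul, smul_eq_mul, Real.norm_of_nonneg (by positivity)]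
  gcongr
  exact norm_sum_le _ _

lemma norm_Ex_le_of {F : Finset (EdgeIdx n) → E} {F' : Finset (EdgeIdx n) → ℝ}
    (h : ∀ G, G.card = m → ‖F G‖ ≤ F' G) : ‖Ex n m F‖ ≤ Ex n m F' :=
  (norm_Ex_le F).trans (Ex_mono h)

lemma Ex_const (hm : m ≤ Fintype.card (EdgeIdx n)) (c : E) : Ex n m (fun _ => c) = c := by
  unfold Ex
  have : ((Fintype.card (EdgeIdx n)).choose m : ℝ) ≠ 0 := by
    exact_mod_cast (Nat.choose_pos hm).ne'
  rw [sum_const, card_powersetCard, card_univ, ← Nat.cast_smul_eq_nsmul ℝ, smul_smul,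
    inv_mul_cancel₀ this, one_smul]

/-- Removing an edge from a uniform graph. -/
lemma step (hm : m < Fintype.card (EdgeIdx n)) (Ψ : Finset (EdgeIdx n) → EdgeIdx n → E) :
    Ex n (m + 1) (fun G => ∑ e ∈ G, Ψ G e) =
      (((m : ℝ) + 1) / ((Fintype.card (EdgeIdx n) : ℝ) - m)) •
        Ex n m (fun H => ∑ e ∈ Hᶜ, Ψ (insert e H) e) := by
  unfold Ex
  have h1 : (∑ G ∈ powersetCard (m + 1) (univ : Finset (EdgeIdx n)), ∑ e ∈ G, Ψ G e) =
      ∑ H ∈ powersetCard m (univ : Finset (EdgeIdx n)), ∑ e ∈ Hᶜ, Ψ (insert e H) e := by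
    rw [sum_sigma', sum_sigma']
    refine sum_bij' (fun x _ => ⟨x.1.erase x.2, x.2⟩) (fun x _ => ⟨insert x.2 x.1, x.2⟩) ?_ ?_ ?_ ?_ ?_
    · rintro ⟨G, e⟩ h
      simp only [mem_sigma, mem_powersetCard, subset_univ, true_and, mem_compl] at h ⊢
      refine ⟨by rw [card_erase_of_mem h.2, h.1]; rfl, by simp⟩
    · rintro ⟨G, e⟩ h
      simp only [mem_sigma, mem_powersetCard, subset_univ, true_and, mem_compl] at h ⊢
      exact ⟨by rw [card_insert_of_notMem h.2, h.1], by simp⟩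
    · rintro ⟨G, e⟩ h
      simp only [mem_sigma, mem_powersetCard, subset_univ, true_and, mem_compl] at h ⊢
      simp [insert_erase h.2]
    · rintro ⟨G, e⟩ h
      simp only [mem_sigma, mem_powersetCard, subset_univ, true_and, mem_compl] at h ⊢
      simp [erase_insert h.2]
    · rintro ⟨G, e⟩ h
      simp only [mem_sigma, mem_powersetCard, subset_univ, true_and, mem_compl] at h ⊢
      simp [insert_erase h.2]
  rw [h1, smul_smul]
  congr 1
  set N := Fintype.card (EdgeIdx n)
  have h2 : (N.choose (m+1) : ℝ) * (m + 1) = N.choose m * ((N : ℝ) - m) := by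
    have := Nat.choose_succ_right_eq N m
    rw [← Nat.cast_sub hm.le]
    exact_mod_cast this
  have h3 : (N.choose (m+1) : ℝ) ≠ 0 := by exact_mod_cast (Nat.choose_pos hm).ne'
  have h4 : (N.choose m : ℝ) ≠ 0 := by exact_mod_cast (Nat.choose_pos hm.le).ne'
  have h5 : (N : ℝ) - m ≠ 0 := sub_ne_zero.2 (by exact_mod_cast hm.ne')
  field_simp
  linarith

/-- Adding an edge to a uniform graph. -/
lemma step' (hm : m < Fintype.card (EdgeIdx n)) (K : Finset (EdgeIdx n) → E) :
    Ex n (m + 1) K =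
      (((Fintype.card (EdgeIdx n) : ℝ) - m)⁻¹) •
        Ex n m (fun H => ∑ e ∈ Hᶜ, K (insert e H)) := by
  have h := step hm (fun G _ => K G)
  have h' : Ex n (m + 1) (fun G => ∑ e ∈ G, K G) = ((m : ℝ) + 1) • Ex n (m + 1) K := by
    rw [← Ex_smul]
    refine Ex_congr fun G hG => ?_
    rw [sum_const, hG, ← Nat.cast_smul_eq_nsmul ℝ]; push_cast; rfl
  rw [h', div_eq_mul_inv, mul_smul] at h
  exact smul_right_injective E (by positivity : ((m : ℝ) + 1) ≠ 0) h

end basic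

section deg
variable {n : ℕ}

lemma card_edges_at (v : Fin n) :
    ((univ : Finset (EdgeIdx n)).filter fun e : EdgeIdx n => v ∈ (e : Sym2 (Fin n))).card = n - 1 := by
  have : ((univ : Finset (EdgeIdx n)).filter fun e : EdgeIdx n => v ∈ (e : Sym2 (Fin n))).card =
      ((univ : Finset (Fin n)).erase v).card := by
    symm
    refine card_bij (fun w hw => ⟨s(v, w), by simpa using (ne_of_mem_erase hw).symm⟩) ?_ ?_ ?_
    · intro w hw; simp
    · intro a ha b hb h
      have h' : a = b ∨ v = b ∧ a = v := by simpa using h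
      rcases h' with h' | ⟨h1, h2⟩
      · exact h'
      · rw [h2, h1]
    · rintro ⟨e, he⟩ h
      simp only [mem_filter, mem_univ, true_and] at h
      obtain ⟨w, rfl⟩ := Sym2.mem_iff_exists.1 h
      exact ⟨w, by simp at he; simp [Ne.symm he], rfl⟩
  rw [this, card_erase_of_mem (mem_univ _), card_univ, Fintype.card_fin]

lemma card_edges_at2 {v w : Fin n} (h : v ≠ w) :
    ((univ : Finset (EdgeIdx n)).filter fun e : EdgeIdx n => v ∈ (e : Sym2 (Fin n)) ∧
      w ∈ (e : Sym2 (Fin n))).card = 1 := by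
  rw [card_eq_one]
  refine ⟨⟨s(v, w), by simpa using h⟩, ?_⟩
  ext ⟨e, he⟩
  simp only [mem_filter, mem_univ, true_and, mem_singleton, Subtype.mk.injEq]
  exact Sym2.mem_and_mem_iff h

lemma card_ends (e : EdgeIdx n) :
    ((univ : Finset (Fin n)).filter fun v => v ∈ (e : Sym2 (Fin n))).card = 2 := by
  obtain ⟨e, he⟩ := e
  induction e with
  | _ a b =>
    have hab : a ≠ b := by simpa using he
    rw [← card_pair hab]
    congr 1
    ext v; simp

lemma card_edge : (Fintype.card (EdgeIdx n) : ℝ) = n * (n - 1) / 2 := by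
  have h : (Fintype.card (EdgeIdx n)) = n.choose 2 := by
    have := Sym2.card_subtype_not_diag (α := Fin n)
    simpa using this
  rw [h, Nat.cast_choose_two]

lemma dg_insert {H : Finset (EdgeIdx n)} {e : EdgeIdx n} (he : e ∉ H) (v : Fin n) :
    dg (insert e H) v = dg H v + if v ∈ (e : Sym2 (Fin n)) then 1 else 0 := by
  unfold dg
  rw [filter_insert]
  split_ifs with h
  · rw [card_insert_of_notMem (by simp [he])]
  · rfl

lemma vs_insert (p : ℕ → ℝ) {H : Finset (EdgeIdx n)} {e : EdgeIdx n} (he : e ∉ H) :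
    vs p (insert e H) = vs p H + es (fd p) H e := by
  unfold vs es fd
  rw [← sum_add_distrib]
  refine sum_congr rfl fun v _ => ?_
  rw [dg_insert he]
  split_ifs <;> simp

lemma es_insert (p : ℕ → ℝ) {H : Finset (EdgeIdx n)} {e : EdgeIdx n} (he : e ∉ H) :
    es p (insert e H) e = es (sh p) H e := by
  unfold es sh
  refine sum_congr rfl fun v _ => ?_
  rw [dg_insert he]
  split_ifs <;> simp

lemma sum_es (p : ℕ → ℝ) (G H : Finset (EdgeIdx n)) :
    ∑ e ∈ G, es p H e = ∑ v, (dg G v : ℝ) * p (dg H v) := by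
  unfold es
  rw [sum_comm]
  refine sum_congr rfl fun v _ => ?_
  rw [← sum_filter, sum_const, nsmul_eq_mul]
  rfl

lemma sum_es_self (p : ℕ → ℝ) (G : Finset (EdgeIdx n)) :
    ∑ e ∈ G, es p G e = vs (fun k => k * p k) G := sum_es p G G

lemma sum_es_univ (p : ℕ → ℝ) (H : Finset (EdgeIdx n)) :
    ∑ e, es p H e = ((n : ℝ) - 1) * vs p H := by
  rw [sum_es, vs, mul_sum]
  refine sum_congr rfl fun v _ => ?_
  have : 1 ≤ n := v.pos
  rw [dg, card_edges_at, Nat.cast_sub this]; simp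

lemma sum_es_mul_es (p q : ℕ → ℝ) (H : Finset (EdgeIdx n)) :
    ∑ e, es p H e * es q H e = ((n : ℝ) - 2) * vs (fun k => p k * q k) H + vs p H * vs q H := by
  have h1 : ∑ e, es p H e * es q H e = ∑ v, ∑ w, p (dg H v) * q (dg H w) *
      (((univ : Finset (EdgeIdx n)).filter fun e : EdgeIdx n => v ∈ (e : Sym2 (Fin n)) ∧
      w ∈ (e : Sym2 (Fin n))).card : ℝ) := by
    unfold es
    simp_rw [sum_mul_sum]
    rw [sum_comm]
    refine sum_congr rfl fun v _ => ?_
    rw [sum_comm]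
    refine sum_congr rfl fun w _ => ?_
    rw [card_eq_sum_ones, Nat.cast_sum, mul_sum, sum_filter]
    refine sum_congr rfl fun e _ => ?_
    by_cases h1 : v ∈ (e : Sym2 (Fin n)) <;> by_cases h2 : w ∈ (e : Sym2 (Fin n)) <;> simp [h1, h2]
  have h2 : ∀ v w : Fin n, (((univ : Finset (EdgeIdx n)).filter fun e : EdgeIdx n => v ∈ (e : Sym2 (Fin n)) ∧
      w ∈ (e : Sym2 (Fin n))).card : ℝ) = 1 + if v = w then ((n : ℝ) - 2) else 0 := by
    intro v w
    by_cases h : v = w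
    · subst h
      have : 1 ≤ n := v.pos
      simp only [and_self, card_edges_at, if_true]
      rw [Nat.cast_sub this]; push_cast; ring
    · rw [card_edges_at2 h]; simp [h]
  rw [h1]
  simp_rw [h2, mul_add, sum_add_distrib, mul_one, ← sum_mul_sum]
  simp only [mul_ite, mul_zero, sum_ite_eq, mem_univ, if_true]
  simp only [vs, ← sum_mul]
  ring

lemma es_mono {p q : ℕ → ℝ} (h : ∀ k, p k ≤ q k) (H : Finset (EdgeIdx n)) (e : EdgeIdx n) :
    es p H e ≤ es q H e := by
  unfold es
  gcongr with v
  split_ifs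
  · exact h _
  · rfl

lemma vs_mono {p q : ℕ → ℝ} (h : ∀ k, p k ≤ q k) (H : Finset (EdgeIdx n)) :
    vs p H ≤ vs q H := by
  unfold vs
  gcongr with v
  exact h _

lemma abs_es_le {p q : ℕ → ℝ} (h : ∀ k, |p k| ≤ q k) (H : Finset (EdgeIdx n)) (e : EdgeIdx n) :
    |es p H e| ≤ es q H e := by
  unfold es
  refine (abs_sum_le_sum_abs _ _).trans ?_
  gcongr with v
  split_ifs
  · exact h _
  · simp

lemma abs_vs_le {p q : ℕ → ℝ} (h : ∀ k, |p k| ≤ q k) (H : Finset (EdgeIdx n)) :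
    |vs p H| ≤ vs q H := by
  unfold vs
  refine (abs_sum_le_sum_abs _ _).trans ?_
  gcongr with v
  exact h _

lemma es_nonneg {p : ℕ → ℝ} (h : ∀ k, 0 ≤ p k) (H : Finset (EdgeIdx n)) (e : EdgeIdx n) :
    0 ≤ es p H e := by
  unfold es
  exact sum_nonneg fun v _ => by split_ifs; exact h _; rfl

lemma vs_nonneg {p : ℕ → ℝ} (h : ∀ k, 0 ≤ p k) (H : Finset (EdgeIdx n)) :
    0 ≤ vs p H := sum_nonneg fun v _ => h _

lemma es_pow_le {p : ℕ → ℝ} (h : ∀ k, 0 ≤ p k) (H : Finset (EdgeIdx n)) (e : EdgeIdx n) (j : ℕ) :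
    es p H e ^ (j + 1) ≤ 2 ^ j * es (fun k => p k ^ (j + 1)) H e := by
  unfold es
  simp_rw [← sum_filter]
  have := pow_sum_div_card_le_sum_pow
    (s := (univ : Finset (Fin n)).filter fun v => v ∈ (e : Sym2 (Fin n)))
    (f := fun v => p (dg H v)) (fun v _ => h _) j
  rw [card_ends, div_le_iff₀ (by positivity)] at this
  push_cast at this
  linarith

lemma vs_pow_le {p : ℕ → ℝ} (h : ∀ k, 0 ≤ p k) (H : Finset (EdgeIdx n)) :
    vs p H ^ 2 ≤ n * vs (fun k => p k ^ 2) H := by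
  unfold vs
  have := sq_sum_le_card_mul_sum_sq (s := (univ : Finset (Fin n))) (f := fun v => p (dg H v))
  simpa using this

end deg
end GnmCLT

namespace GnmCLT

/-- Mean of `ψ` under the Poisson distribution. -/
def pm (μ : ℝ) (ψ : ℕ → ℝ) : ℝ := ∑' k, ψ k * poissonProb μ k

/-- exponentially bounded sequences -/
def EB (ψ : ℕ → ℝ) : Prop := ∃ C B : ℝ, ∀ k, |ψ k| ≤ C * B ^ k

lemma EB_iff {ψ : ℕ → ℝ} : EB ψ ↔ ∃ C B : ℝ, 1 ≤ C ∧ 2 ≤ B ∧ ∀ k, |ψ k| ≤ C * B ^ k := by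
  constructor
  · rintro ⟨C, B, h⟩
    refine ⟨max |C| 1, max |B| 2, le_max_right _ _, le_max_right _ _, fun k => (h k).trans ?_⟩
    calc C * B ^ k ≤ |C * B ^ k| := le_abs_self _
      _ = |C| * |B| ^ k := by rw [abs_mul, abs_pow]
      _ ≤ _ := by gcongr <;> exact le_max_left _ _
  · rintro ⟨C, B, _, _, h⟩
    exact ⟨C, B, h⟩

lemma pp_nonneg {μ : ℝ} (hμ : 0 ≤ μ) (k : ℕ) : 0 ≤ poissonProb μ k := by
  unfold poissonProb; positivity

lemma summable_CB (μ C B : ℝ) : Summable fun k => C * B ^ k * poissonProb μ k := by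
  have := (Real.summable_pow_div_factorial (B * μ)).mul_left (C * Real.exp (-μ))
  refine this.congr fun k => ?_
  unfold poissonProb
  rw [mul_pow]; ring

lemma tsum_CB (μ C B : ℝ) : ∑' k, C * B ^ k * poissonProb μ k = C * Real.exp (B * μ - μ) := by
  have : ∀ k : ℕ, C * B ^ k * poissonProb μ k =
      (C * Real.exp (-μ)) * ((B * μ) ^ k / k.factorial) := by
    intro k
    unfold poissonProb
    rw [mul_pow]; ring
  simp_rw [this]
  rw [tsum_mul_left, sub_eq_add_neg, Real.exp_add, Real.exp_eq_exp_ℝ, NormedSpace.exp_eq_tsum_div]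
  ring

lemma EB.summable {ψ : ℕ → ℝ} (h : EB ψ) {μ : ℝ} (hμ : 0 ≤ μ) :
    Summable fun k => ψ k * poissonProb μ k := by
  obtain ⟨C, B, h⟩ := h
  refine Summable.of_norm_bounded (summable_CB μ C B) fun k => ?_
  rw [Real.norm_eq_abs, abs_mul, abs_of_nonneg (pp_nonneg hμ k)]
  exact mul_le_mul_of_nonneg_right (h k) (pp_nonneg hμ k)

lemma abs_pm_le {ψ : ℕ → ℝ} {C B : ℝ} (h : ∀ k, |ψ k| ≤ C * B ^ k) {μ : ℝ} (hμ : 0 ≤ μ) :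
    |pm μ ψ| ≤ C * Real.exp (B * μ - μ) := by
  rw [← tsum_CB]
  have := tsum_of_norm_bounded (summable_CB μ C B).hasSum (f := fun k => ψ k * poissonProb μ k)
    fun k => by
    rw [Real.norm_eq_abs, abs_mul, abs_of_nonneg (pp_nonneg hμ k)]
    exact mul_le_mul_of_nonneg_right (h k) (pp_nonneg hμ k)
  exact this

lemma EB.add {p q : ℕ → ℝ} (hp : EB p) (hq : EB q) : EB fun k => p k + q k := by
  obtain ⟨C, B, hC, hB, h⟩ := EB_iff.1 hp
  obtain ⟨C', B', hC', hB', h'⟩ := EB_iff.1 hq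
  refine ⟨C + C', max B B', fun k => ?_⟩
  calc |p k + q k| ≤ |p k| + |q k| := abs_add_le _ _
    _ ≤ C * B ^ k + C' * B' ^ k := add_le_add (h k) (h' k)
    _ ≤ C * (max B B') ^ k + C' * (max B B') ^ k := by
        gcongr
        · exact le_max_left _ _
        · exact le_max_right _ _
    _ = _ := by ring

lemma EB.mul {p q : ℕ → ℝ} (hp : EB p) (hq : EB q) : EB fun k => p k * q k := by
  obtain ⟨C, B, hC, hB, h⟩ := EB_iff.1 hp
  obtain ⟨C', B', hC', hB', h'⟩ := EB_iff.1 hq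
  refine ⟨C * C', B * B', fun k => ?_⟩
  calc |p k * q k| = |p k| * |q k| := abs_mul _ _
    _ ≤ (C * B ^ k) * (C' * B' ^ k) := by
        gcongr
        · exact h k
        · exact h' k
    _ = _ := by rw [mul_pow]; ring

lemma EB.const (c : ℝ) : EB fun _ => c := ⟨|c|, 1, fun k => by simp⟩

lemma EB.id : EB fun k => (k : ℝ) := ⟨1, 2, fun k => by
  rw [abs_of_nonneg (by positivity), one_mul]
  have := k.lt_two_pow_self.le
  show (k : ℝ) ≤ 2 ^ k
  exact_mod_cast this⟩

lemma EB.neg {p : ℕ → ℝ} (hp : EB p) : EB fun k => - p k := by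
  obtain ⟨C, B, h⟩ := hp
  exact ⟨C, B, fun k => by rw [abs_neg]; exact h k⟩

lemma EB.sub {p q : ℕ → ℝ} (hp : EB p) (hq : EB q) : EB fun k => p k - q k := by
  simpa [sub_eq_add_neg] using hp.add hq.neg

lemma EB.sh {p : ℕ → ℝ} (hp : EB p) : EB (sh p) := by
  obtain ⟨C, B, h⟩ := hp
  exact ⟨C * B, B, fun k => by
    have := h (k + 1)
    rw [pow_succ] at this
    unfold GnmCLT.sh; linarith⟩

lemma EB.fd {p : ℕ → ℝ} (hp : EB p) : EB (fd p) := hp.sh.sub hp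

section lin
variable {μ : ℝ} {p q : ℕ → ℝ}

lemma pm_add (hμ : 0 ≤ μ) (hp : EB p) (hq : EB q) : pm μ (fun k => p k + q k) = pm μ p + pm μ q := by
  unfold pm
  rw [← (hp.summable hμ).tsum_add (hq.summable hμ)]
  simp_rw [add_mul]

lemma pm_sub (hμ : 0 ≤ μ) (hp : EB p) (hq : EB q) : pm μ (fun k => p k - q k) = pm μ p - pm μ q := by
  unfold pm
  rw [← (hp.summable hμ).tsum_sub (hq.summable hμ)]
  simp_rw [sub_mul]

lemma pm_cmul (c : ℝ) : pm μ (fun k => c * p k) = c * pm μ p := by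
  unfold pm
  rw [← tsum_mul_left]
  simp_rw [mul_assoc]

lemma pm_const (c : ℝ) : pm μ (fun _ => c) = c := by
  have := tsum_CB μ c 1
  unfold pm
  simpa using this

/-- size-bias identity for the Poisson distribution -/
lemma pm_shift (hμ : 0 ≤ μ) (hp : EB p) : pm μ (fun k => k * p k) = μ * pm μ (sh p) := by
  unfold pm
  rw [((EB.id.mul hp).summable hμ).tsum_eq_zero_add, ← tsum_mul_left]
  simp only [Nat.cast_zero, zero_mul, zero_add]
  refine tsum_congr fun k => ?_
  unfold poissonProb sh
  rw [Nat.factorial_succ, pow_succ]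
  push_cast
  field_simp

end lin

/-- Solution of the Stein equation for the Poisson distribution. -/
def stein (μ : ℝ) (g : ℕ → ℝ) : ℕ → ℝ
  | 0 => 0
  | k + 1 => ∑' i : ℕ, g (k + 1 + i) * (μ ^ i * k.factorial / (k + 1 + i).factorial)

lemma fact_bd (k i : ℕ) : ((k.factorial : ℝ) / (k + 1 + i).factorial) ≤ 1 / i.factorial := by
  rw [div_le_div_iff₀ (by positivity) (by positivity), one_mul]
  have h1 : k.factorial * i.factorial ≤ (k + i).factorial := Nat.le_of_dvd (Nat.factorial_pos _)
    (Nat.factorial_mul_factorial_dvd_factorial_add k i)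
  have h2 : (k + i).factorial ≤ (k + 1 + i).factorial := Nat.factorial_le (by omega)
  exact_mod_cast h1.trans h2

lemma stein_term {μ : ℝ} (hμ : 0 ≤ μ) {g : ℕ → ℝ} {C B : ℝ} (h : ∀ k, |g k| ≤ C * B ^ k)
    (k i : ℕ) : ‖g (k + 1 + i) * (μ ^ i * k.factorial / (k + 1 + i).factorial)‖ ≤
      C * B ^ (k + 1) * ((B * μ) ^ i / i.factorial) := by
  have h0 := h (k + 1 + i)
  rw [Real.norm_eq_abs, abs_mul, abs_of_nonneg (by positivity : 0 ≤ μ ^ i * k.factorial / ((k + 1 + i).factorial : ℝ)), mul_div_assoc]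
  have h1 := fact_bd k i
  calc _ ≤ (C * B ^ (k + 1 + i)) * (μ ^ i * (1 / i.factorial)) := by
        refine mul_le_mul h0 (mul_le_mul_of_nonneg_left h1 (by positivity)) (by positivity)
          ((abs_nonneg _).trans h0)
    _ = _ := by rw [pow_add, mul_pow]; ring

lemma stein_bound {μ : ℝ} (hμ : 0 ≤ μ) {g : ℕ → ℝ} {C B : ℝ} (hB : 0 ≤ B) (hC : 0 ≤ C)
    (h : ∀ k, |g k| ≤ C * B ^ k)
    (k : ℕ) : |stein μ g k| ≤ C * Real.exp (B * μ) * B ^ k := by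
  cases k with
  | zero => simp only [stein, abs_zero]; positivity
  | succ k =>
    have h1 := (Real.summable_pow_div_factorial (B * μ)).mul_left (C * B ^ (k + 1))
    have := tsum_of_norm_bounded h1.hasSum (stein_term hμ h k)
    rw [tsum_mul_left] at this
    rw [Real.exp_eq_exp_ℝ, NormedSpace.exp_eq_tsum_div]
    calc _ ≤ _ := this
      _ = _ := by ring

lemma stein_eq {μ : ℝ} (hμ : 0 ≤ μ) {g : ℕ → ℝ} (hg : EB g) (h0 : pm μ g = 0) (k : ℕ) :
    (k : ℝ) * stein μ g k - μ * stein μ g (k + 1) = g k := by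
  obtain ⟨C, B, hb⟩ := id hg
  cases k with
  | zero =>
    unfold pm at h0
    rw [(hg.summable hμ).tsum_eq_zero_add] at h0
    have h1 : μ * stein μ g (0 + 1) = Real.exp μ * ∑' b : ℕ, g (b + 1) * poissonProb μ (b + 1) := by
      simp only [stein]
      rw [← tsum_mul_left, ← tsum_mul_left]
      refine tsum_congr fun i => ?_
      have : Real.exp μ * Real.exp (-μ) = 1 := by rw [← Real.exp_add]; simp
      unfold poissonProb
      rw [show 0 + 1 + i = i + 1 by omega, pow_succ]
      field_simp
      simp only [Nat.factorial_zero, Nat.cast_one]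
      linear_combination (-μ ^ i * μ * g (i + 1)) * this
    have h2 : Real.exp μ * poissonProb μ 0 = 1 := by
      unfold poissonProb; simp [← Real.exp_add]
    rw [h1]
    push_cast
    linear_combination (-Real.exp μ) * h0 + g 0 * h2
  | succ k =>
    have hs : Summable fun i : ℕ => g (k + 1 + i) * (μ ^ i * k.factorial / (k + 1 + i).factorial) := by
      refine Summable.of_norm_bounded ((Real.summable_pow_div_factorial (B * μ)).mul_left (C * B ^ (k + 1))) (stein_term hμ hb k)
    simp only [stein]
    rw [hs.tsum_eq_zero_add, mul_add, ← tsum_mul_left, ← tsum_mul_left]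
    have : ∀ i : ℕ, ((k + 1 : ℕ) : ℝ) * (g (k + 1 + (i + 1)) * (μ ^ (i + 1) * k.factorial / (k + 1 + (i + 1)).factorial)) =
      μ * (g (k + 1 + 1 + i) * (μ ^ i * (k + 1).factorial / (k + 1 + 1 + i).factorial)) := by
      intro i
      rw [show k + 1 + (i + 1) = k + 1 + 1 + i by omega, Nat.factorial_succ k]
      push_cast
      ring
    simp_rw [this]
    rw [add_sub_cancel_right, add_zero, Nat.factorial_succ k]
    push_cast
    field_simp

/-- Limiting variance. -/
def VV (μ : ℝ) (f : ℕ → ℝ) : ℝ :=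
  pm μ (fun k => f k * f k) - pm μ f ^ 2 - (pm μ (fun k => k * f k) - μ * pm μ f) ^ 2 / μ

lemma var_identity {μ : ℝ} (hμ : 0 < μ) {f h : ℕ → ℝ} (hf : EB f) (hh : EB h)
    (heq : ∀ k : ℕ, (k : ℝ) * h k - μ * h (k + 1) = f k - pm μ f) :
    μ * (pm μ (fun k => sh h k * fd f k) - pm μ (sh h) * pm μ (fd f)) = VV μ f := by
  have hp := hμ.le
  set c := pm μ f with hc
  -- E[(f-c) f]
  have e1 : pm μ (fun k => f k * f k) - c * c = μ * pm μ (fun k => sh h k * fd f k) := by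
    have a1 : pm μ (fun k => f k * f k) - c * c = pm μ (fun k => (f k - c) * f k) := by
      have := pm_sub hp (hf.mul hf) ((EB.const c).mul hf)
      simp_rw [sub_mul]
      rw [this, pm_cmul]
    have a2 : pm μ (fun k => (f k - c) * f k) =
        pm μ (fun k => k * (h k * f k)) - μ * pm μ (fun k => sh h k * f k) := by
      have := pm_sub hp (EB.id.mul (hh.mul hf)) ((EB.const μ).mul (hh.sh.mul hf))
      rw [pm_cmul] at this
      rw [← this]
      congr 1; ext k
      rw [← heq]; unfold sh; ring
    have a3 := pm_shift hp (hh.mul hf)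
    have a4 : pm μ (fun k => sh h k * fd f k) = pm μ (sh fun k => h k * f k) - pm μ (fun k => sh h k * f k) := by
      rw [← pm_sub hp (hh.mul hf).sh (hh.sh.mul hf)]
      congr 1; ext k; simp only [sh, fd]; ring
    rw [a1, a2, a3, a4]; ring
  have e2 : pm μ (fun k => k * f k) - μ * c = μ * pm μ (sh h) := by
    have a1 : pm μ (fun k => k * f k) - μ * c = pm μ (fun k => k * (f k - c)) := by
      have := pm_sub hp (EB.id.mul hf) ((EB.const c).mul EB.id)
      have h1 : pm μ (fun k => (k : ℝ)) = μ := by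
        have := pm_shift hp (EB.const 1)
        simp only [mul_one] at this
        rw [this]; unfold sh; rw [pm_const, mul_one]
      rw [pm_cmul, h1, mul_comm c μ] at this
      rw [← this]
      congr 1; ext k; ring
    have a2 : pm μ (fun k => k * (f k - c)) =
        pm μ (fun k => k * (k * h k)) - μ * pm μ (fun k => k * sh h k) := by
      have := pm_sub hp (EB.id.mul (EB.id.mul hh)) ((EB.const μ).mul (EB.id.mul hh.sh))
      rw [pm_cmul] at this
      rw [← this]
      congr 1; ext k
      rw [← heq]; unfold sh; ring
    have a3 := pm_shift hp (EB.id.mul hh)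
    have a4 : pm μ (sh h) = pm μ (sh fun k => k * h k) - pm μ (fun k => k * sh h k) := by
      rw [← pm_sub hp (EB.id.mul hh).sh (EB.id.mul hh.sh)]
      congr 1; ext k; simp only [sh]; push_cast; ring
    rw [a2, a3] at a1
    rw [a1, a4]; ring
  have e3 : pm μ (fun k => k * f k) - μ * c = μ * pm μ (fd f) := by
    rw [pm_shift hp hf]
    have : pm μ (fd f) = pm μ (sh f) - pm μ f := pm_sub hp hf.sh hf
    rw [this]; ring
  unfold VV
  rw [← hc]
  have e4 : (pm μ (fun k => k * f k) - μ * c) ^ 2 / μ = μ * pm μ (sh h) * pm μ (fd f) := by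
    rw [sq]; nth_rewrite 1 [e2]; rw [e3]; field_simp
  rw [e4]
  linear_combination -e1

lemma pm_continuous {p : ℕ → ℝ} (hp : EB p) {μ : ℝ} (hμ : 0 < μ) : ContinuousAt (fun x => pm x p) μ := by
  obtain ⟨C, B, hC, hB, h⟩ := EB_iff.1 hp
  have : Tendsto (fun x => pm x p) (𝓝 μ) (𝓝 (pm μ p)) := by
    unfold pm
    refine tendsto_tsum_of_dominated_convergence (bound := fun k => C * ((B * (2 * μ)) ^ k / k.factorial))
      ((Real.summable_pow_div_factorial _).mul_left C) ?_ ?_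
    · intro k
      have : Continuous fun x => p k * poissonProb x k := by unfold poissonProb; fun_prop
      exact this.tendsto _
    · have : ∀ᶠ x in 𝓝 μ, 0 < x ∧ x < 2 * μ :=
        (eventually_gt_nhds hμ).and (eventually_lt_nhds (by linarith))
      filter_upwards [this] with x hx k
      have hx0 := hx.1
      rw [Real.norm_eq_abs, abs_mul, abs_of_nonneg (pp_nonneg hx.1.le k), mul_pow]
      unfold poissonProb
      have : Real.exp (-x) ≤ 1 := by rw [Real.exp_le_one_iff]; linarith
      calc |p k| * (Real.exp (-x) * x ^ k / k.factorial)
          ≤ (C * B ^ k) * (1 * (2 * μ) ^ k / k.factorial) := by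
            gcongr
            · exact h k
            · exact hx.2.le
        _ = _ := by ring
  exact this

lemma VV_continuous {p : ℕ → ℝ} (hp : EB p) {μ : ℝ} (hμ : 0 < μ) : ContinuousAt (fun x => VV x p) μ := by
  unfold VV
  have h1 := pm_continuous hp hμ
  have h2 := pm_continuous (hp.mul hp) hμ
  have h3 := pm_continuous (EB.id.mul hp) hμ
  refine (h2.sub (h1.pow 2)).sub (ContinuousAt.div ((h3.sub (continuousAt_id.mul h1)).pow 2) continuousAt_id hμ.ne')

lemma VV_eq_tsum {μ : ℝ} (hμ : 0 < μ) {a : ℕ → ℝ} (ha : EB a) :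
    (∑' j : ℕ, ∑' k : ℕ, a j * a k *
            (poissonProb μ j * poissonProb μ k *
                (-(((j : ℝ) - μ) * ((k : ℝ) - μ) / μ) - 1) +
              poissonProb μ k * (if j = k then 1 else 0))) = VV μ a := by
  have hp := hμ.le
  set X := pm μ (fun k => k * a k) - μ * pm μ a with hX
  have hb : EB fun k => ((k : ℝ) - μ) * a k := (EB.id.sub (EB.const μ)).mul ha
  have hXe : pm μ (fun k => ((k : ℝ) - μ) * a k) = X := by
    have := pm_sub hp (EB.id.mul ha) ((EB.const μ).mul ha)
    rw [pm_cmul] at this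
    rw [hX, ← this]; congr 1; ext k; ring
  have inner : ∀ j : ℕ, (∑' k : ℕ, a j * a k *
            (poissonProb μ j * poissonProb μ k *
                (-(((j : ℝ) - μ) * ((k : ℝ) - μ) / μ) - 1) +
              poissonProb μ k * (if j = k then 1 else 0))) =
      (a j * a j) * poissonProb μ j + ((-X / μ) * (((j : ℝ) - μ) * a j)) * poissonProb μ j -
        (pm μ a * a j) * poissonProb μ j := by
    intro j
    have h1 := ((hb.summable hp).hasSum).mul_left (-(((j : ℝ) - μ) * a j * poissonProb μ j) / μ)
    have h2 := ((ha.summable hp).hasSum).mul_left (a j * poissonProb μ j)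
    have h3 : HasSum (fun k : ℕ => if k = j then a j * a j * poissonProb μ j else 0)
      (a j * a j * poissonProb μ j) := hasSum_ite_eq _ _
    have h4 := (h3.add h1).sub h2
    refine (tsum_congr fun k => ?_).trans (h4.tsum_eq.trans ?_)
    · by_cases hjk : j = k
      · subst hjk; simp; field_simp; ring
      · simp [hjk, Ne.symm hjk]; field_simp
    · symm
      change _ = a j * a j * poissonProb μ j + -(((j : ℝ) - μ) * a j * poissonProb μ j) / μ *
        pm μ (fun k => ((k : ℝ) - μ) * a k) - a j * poissonProb μ j * pm μ a
      rw [hXe]; ring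
  simp_rw [inner]
  have hb' : EB fun k => (-X / μ) * (((k : ℝ) - μ) * a k) := (EB.const _).mul hb
  have hc' : EB fun k => pm μ a * a k := (EB.const _).mul ha
  rw [(((ha.mul ha).summable hp).add (hb'.summable hp)).tsum_sub (hc'.summable hp),
    ((ha.mul ha).summable hp).tsum_add (hb'.summable hp)]
  change pm μ (fun k => a k * a k) + pm μ (fun k => (-X / μ) * (((k : ℝ) - μ) * a k)) -
    pm μ (fun k => pm μ a * a k) = _
  rw [pm_cmul, pm_cmul, hXe, VV, ← hX]
  ring

end GnmCLT

namespace GnmCLT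
open Finset

/-- The coefficient appearing in the fundamental identity. -/
def Bc {n : ℕ} (m : ℕ) (μ : ℝ) (p : ℕ → ℝ) (H : Finset (EdgeIdx n)) (e : EdgeIdx n) : ℝ :=
  ((m : ℝ) + 1) * es p H e - μ * vs p H - μ * es (fd p) H e

lemma key {E : Type*} [NormedAddCommGroup E] [NormedSpace ℝ E] {n m : ℕ}
    (hm : m < Fintype.card (EdgeIdx n)) (μ : ℝ) {g h : ℕ → ℝ}
    (hg : ∀ k : ℕ, (k : ℝ) * h k - μ * h (k + 1) = g k) (K : Finset (EdgeIdx n) → E) :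
    Ex n (m + 1) (fun G => vs g G • K G) = ((Fintype.card (EdgeIdx n) : ℝ) - m)⁻¹ •
      Ex n m (fun H => ∑ e ∈ Hᶜ, Bc m μ (sh h) H e • K (insert e H)) := by
  have h1 : ∀ G : Finset (EdgeIdx n), vs g G • K G =
      (∑ e ∈ G, es h G e • K G) - (μ * vs (sh h) G) • K G := by
    intro G
    rw [← sum_smul, ← sub_smul, sum_es_self]
    congr 1
    unfold vs
    rw [mul_sum, ← sum_sub_distrib]
    exact sum_congr rfl fun v _ => (hg _).symm
  simp_rw [h1]
  rw [Ex_sub, step hm, step' hm, div_eq_mul_inv, mul_comm, mul_smul, ← smul_sub, ← Ex_smul, ← Ex_sub]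
  congr 1
  refine Ex_congr fun H _ => ?_
  rw [smul_sum, ← sum_sub_distrib]
  refine sum_congr rfl fun e he => ?_
  have he : e ∉ H := by simpa using he
  rw [smul_smul, ← sub_smul, es_insert h he, vs_insert _ he, Bc]
  congr 1
  ring

section bounds
variable {n m : ℕ} {b : ℕ → ℝ}

/-- Sum of powers of the dominating sequence. -/
def TT (b : ℕ → ℝ) (j : ℕ) (H : Finset (EdgeIdx n)) : ℝ := vs (fun k => b k ^ j) H

lemma TT_nonneg (hb : ∀ k, 1 ≤ b k) (j : ℕ) (H : Finset (EdgeIdx n)) : 0 ≤ TT b j H :=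
  vs_nonneg (fun k => pow_nonneg (zero_le_one.trans (hb k)) _) H

lemma TT_mono (hb : ∀ k, 1 ≤ b k) {i j : ℕ} (hij : i ≤ j) (H : Finset (EdgeIdx n)) :
    TT b i H ≤ TT b j H :=
  vs_mono (fun k => pow_le_pow_right₀ (hb k) hij) H

lemma TT_sq (hb : ∀ k, 1 ≤ b k) (j : ℕ) (H : Finset (EdgeIdx n)) :
    TT b j H ^ 2 ≤ n * TT b (2 * j) H := by
  have := vs_pow_le (p := fun k => b k ^ j) (fun k => pow_nonneg (zero_le_one.trans (hb k)) _) H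
  simpa only [TT, ← pow_mul, mul_comm j 2] using this

lemma TT12 (hb : ∀ k, 1 ≤ b k) (H : Finset (EdgeIdx n)) :
    TT b 1 H * TT b 2 H ≤ n * TT b 4 H := by
  have h1 := TT_mono hb (show 1 ≤ 2 by norm_num) H
  have h2 := TT_sq hb 2 H
  have h3 := TT_nonneg hb 2 H
  have h4 := TT_nonneg hb 1 H
  norm_num at h2
  nlinarith

lemma vs_b_eq (H : Finset (EdgeIdx n)) : vs b H = TT b 1 H := by simp [TT]

lemma sum_es_sq_univ (hb : ∀ k, 1 ≤ b k) (hn : 1 ≤ n) (H : Finset (EdgeIdx n)) :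
    ∑ e, es b H e ^ 2 ≤ 2 * n * TT b 2 H := by
  have h0 : ∀ k, 0 ≤ b k := fun k => zero_le_one.trans (hb k)
  calc ∑ e, es b H e ^ 2 ≤ ∑ e, 2 * es (fun k => b k ^ 2) H e := by
        gcongr with e
        simpa using es_pow_le h0 H e 1
    _ = 2 * (((n : ℝ) - 1) * TT b 2 H) := by rw [← mul_sum, sum_es_univ, TT]
    _ ≤ _ := by nlinarith [TT_nonneg hb 2 H]

lemma sum_es_cube_univ (hb : ∀ k, 1 ≤ b k) (hn : 1 ≤ n) (H : Finset (EdgeIdx n)) :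
    ∑ e, es b H e ^ 3 ≤ 4 * n * TT b 3 H := by
  have h0 : ∀ k, 0 ≤ b k := fun k => zero_le_one.trans (hb k)
  calc ∑ e, es b H e ^ 3 ≤ ∑ e, 4 * es (fun k => b k ^ 3) H e := by
        gcongr with e
        have := es_pow_le h0 H e 2
        norm_num at this
        exact this
    _ = 4 * (((n : ℝ) - 1) * TT b 3 H) := by rw [← mul_sum, sum_es_univ, TT]
    _ ≤ _ := by nlinarith [TT_nonneg hb 3 H]

lemma sum_es_one_univ (hb : ∀ k, 1 ≤ b k) (hn : 1 ≤ n) (H : Finset (EdgeIdx n)) :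
    ∑ e, es b H e ≤ n * TT b 1 H := by
  rw [sum_es_univ, vs_b_eq]
  nlinarith [TT_nonneg hb 1 H]

lemma sum_es_one_self (hb : ∀ k, 1 ≤ b k) (hk : ∀ k : ℕ, (k : ℝ) ≤ b k) (H : Finset (EdgeIdx n)) :
    ∑ e ∈ H, es b H e ≤ TT b 2 H := by
  have h0 : ∀ k, 0 ≤ b k := fun k => zero_le_one.trans (hb k)
  rw [sum_es_self]
  refine vs_mono (fun k => ?_) H
  rw [sq]
  exact mul_le_mul_of_nonneg_right (hk k) (h0 k)

lemma sum_es_sq_self (hb : ∀ k, 1 ≤ b k) (hk : ∀ k : ℕ, (k : ℝ) ≤ b k) (H : Finset (EdgeIdx n)) :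
    ∑ e ∈ H, es b H e ^ 2 ≤ 2 * TT b 3 H := by
  have h0 : ∀ k, 0 ≤ b k := fun k => zero_le_one.trans (hb k)
  calc ∑ e ∈ H, es b H e ^ 2 ≤ ∑ e ∈ H, 2 * es (fun k => b k ^ 2) H e := by
        gcongr with e
        simpa using es_pow_le h0 H e 1
    _ = 2 * vs (fun k => k * b k ^ 2) H := by rw [← mul_sum, sum_es_self]
    _ ≤ _ := by
      gcongr
      refine vs_mono (fun k => ?_) H
      rw [pow_succ _ 2, mul_comm]
      exact mul_le_mul_of_nonneg_left (hk k) (pow_nonneg (h0 k) _)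

/-- Standing hypotheses for the pointwise bounds. -/
structure Hyp (n m : ℕ) (μ Λ : ℝ) (b p q : ℕ → ℝ) : Prop where
  hn : 1 ≤ n
  hb : ∀ k, 1 ≤ b k
  hk : ∀ k : ℕ, (k : ℝ) ≤ b k
  hμ : μ * n = 2 * ((m : ℝ) + 1)
  hμ0 : 0 ≤ μ
  hμΛ : μ ≤ Λ
  hΛ : 1 ≤ Λ
  hp : ∀ k, |p k| ≤ b k
  hdp : ∀ k, |fd p k| ≤ b k
  hq : ∀ k, |q k| ≤ b k

variable {μ Λ : ℝ} {p q : ℕ → ℝ}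

lemma Hyp.m_le (h : Hyp n m μ Λ b p q) : (m : ℝ) + 1 ≤ Λ * n / 2 := by
  have h1 := h.hμ
  have h2 := mul_le_mul_of_nonneg_right h.hμΛ (Nat.cast_nonneg (α := ℝ) n)
  linarith

lemma Hyp.P1 (h : Hyp n m μ Λ b p q) {H : Finset (EdgeIdx n)} (hH : H.card = m) :
    |∑ e ∈ Hᶜ, Bc m μ p H e| ≤ 2 * Λ ^ 2 * n * TT b 2 H := by
  have hn : (1 : ℝ) ≤ n := by exact_mod_cast h.hn
  have hm := h.m_le
  have e1 : ∑ e ∈ Hᶜ, Bc m μ p H e = -((m : ℝ) + 1) * (∑ e ∈ H, es p H e) + μ * m * vs p H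
      - μ * ∑ e ∈ Hᶜ, es (fd p) H e := by
    have a1 : ∑ e ∈ Hᶜ, Bc m μ p H e = (∑ e ∈ Hᶜ, (((m : ℝ) + 1) * es p H e - μ * vs p H))
      - μ * ∑ e ∈ Hᶜ, es (fd p) H e := by
      rw [mul_sum, ← sum_sub_distrib]; rfl
    have a2 := sum_compl_add_sum H (fun e => ((m : ℝ) + 1) * es p H e - μ * vs p H)
    have a3 : ∑ e, (((m : ℝ) + 1) * es p H e - μ * vs p H) = 0 := by
      rw [sum_sub_distrib, ← mul_sum, sum_es_univ, sum_const, card_univ, nsmul_eq_mul, card_edge]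
      linear_combination (-(((n : ℝ) - 1) * vs p H) / 2) * h.hμ
    have a4 : ∑ e ∈ H, (((m : ℝ) + 1) * es p H e - μ * vs p H) =
      ((m : ℝ) + 1) * (∑ e ∈ H, es p H e) - μ * m * vs p H := by
      rw [sum_sub_distrib, ← mul_sum, sum_const, hH, nsmul_eq_mul]; ring
    rw [a1]
    linarith
  have b1 : |∑ e ∈ H, es p H e| ≤ TT b 2 H :=
    ((abs_sum_le_sum_abs _ _).trans (sum_le_sum fun e _ => abs_es_le h.hp H e)).trans
      (sum_es_one_self h.hb h.hk H)
  have b2 : |vs p H| ≤ TT b 2 H := by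
    have := abs_vs_le h.hp H
    rw [vs_b_eq (b := b)] at this
    exact this.trans (TT_mono h.hb (by norm_num) H)
  have b3 : |∑ e ∈ Hᶜ, es (fd p) H e| ≤ n * TT b 2 H := by
    refine (abs_sum_le_sum_abs _ _).trans ((sum_le_sum fun e _ => abs_es_le h.hdp H e).trans ?_)
    refine (sum_le_univ_sum_of_nonneg fun e => es_nonneg (fun k => zero_le_one.trans (h.hb k)) H e).trans ?_
    refine (sum_es_one_univ h.hb h.hn H).trans ?_
    gcongr
    exact TT_mono h.hb (by norm_num) H
  have hT := TT_nonneg h.hb 2 H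
  have hμ0 := h.hμ0
  have hμΛ := h.hμΛ
  have hΛ := h.hΛ
  rw [e1]
  calc _ ≤ |-((m : ℝ) + 1) * (∑ e ∈ H, es p H e)| + |μ * m * vs p H| +
        |μ * ∑ e ∈ Hᶜ, es (fd p) H e| := (abs_sub _ _).trans (add_le_add_left (abs_add_le _ _) _)
    _ = ((m : ℝ) + 1) * |∑ e ∈ H, es p H e| + μ * m * |vs p H| + μ * |∑ e ∈ Hᶜ, es (fd p) H e| := by
        rw [abs_mul, abs_mul, abs_mul, abs_neg, abs_of_nonneg (by positivity : 0 ≤ (m : ℝ) + 1),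
          abs_mul, abs_of_nonneg hμ0, abs_of_nonneg (Nat.cast_nonneg (α := ℝ) m)]
    _ ≤ (Λ * n / 2) * TT b 2 H + Λ * (Λ * n / 2) * TT b 2 H + Λ * (n * TT b 2 H) := by
        gcongr; linarith
    _ = (3 * Λ + Λ ^ 2) / 2 * n * TT b 2 H := by ring
    _ ≤ _ := by gcongr; nlinarith

lemma Hyp.P2 (h : Hyp n m μ Λ b p q) {H : Finset (EdgeIdx n)} (hH : H.card = m) :
    |∑ e ∈ Hᶜ, Bc m μ p H e * es q H e - ((m : ℝ) + 1) * ((n : ℝ) - 2) *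
      (vs (fun k => p k * q k) H - vs p H * vs q H / n)| ≤ 4 * Λ * n * TT b 4 H := by
  have hn : (1 : ℝ) ≤ n := by exact_mod_cast h.hn
  have hm := h.m_le
  have e1 : ∑ e ∈ Hᶜ, Bc m μ p H e * es q H e - ((m : ℝ) + 1) * ((n : ℝ) - 2) *
      (vs (fun k => p k * q k) H - vs p H * vs q H / n) =
      -((m : ℝ) + 1) * (∑ e ∈ H, es p H e * es q H e) + μ * vs p H * (∑ e ∈ H, es q H e)
      - μ * ∑ e ∈ Hᶜ, es (fd p) H e * es q H e := by
    have a1 : ∑ e ∈ Hᶜ, Bc m μ p H e * es q H e =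
      (∑ e ∈ Hᶜ, (((m : ℝ) + 1) * (es p H e * es q H e) - μ * vs p H * es q H e))
      - μ * ∑ e ∈ Hᶜ, es (fd p) H e * es q H e := by
      rw [mul_sum, ← sum_sub_distrib]
      refine sum_congr rfl fun e _ => ?_
      unfold Bc; ring
    have a2 := sum_compl_add_sum H
      (fun e => ((m : ℝ) + 1) * (es p H e * es q H e) - μ * vs p H * es q H e)
    have a3 : ∑ e, (((m : ℝ) + 1) * (es p H e * es q H e) - μ * vs p H * es q H e) =
        ((m : ℝ) + 1) * ((n : ℝ) - 2) * (vs (fun k => p k * q k) H - vs p H * vs q H / n) := by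
      rw [sum_sub_distrib, ← mul_sum, ← mul_sum, sum_es_univ, sum_es_mul_es]
      have : μ = 2 * ((m : ℝ) + 1) / n := by rw [← h.hμ]; field_simp
      rw [this]
      field_simp
      ring
    have a4 : ∑ e ∈ H, (((m : ℝ) + 1) * (es p H e * es q H e) - μ * vs p H * es q H e) =
      ((m : ℝ) + 1) * (∑ e ∈ H, es p H e * es q H e) - μ * vs p H * (∑ e ∈ H, es q H e) := by
      rw [sum_sub_distrib, ← mul_sum, ← mul_sum]
    rw [a1]
    linarith
  have h0 : ∀ k, 0 ≤ b k := fun k => zero_le_one.trans (h.hb k)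
  have b1 : |∑ e ∈ H, es p H e * es q H e| ≤ 2 * TT b 3 H := by
    refine (abs_sum_le_sum_abs _ _).trans ((sum_le_sum fun e _ => ?_).trans
      (sum_es_sq_self h.hb h.hk H))
    rw [abs_mul, sq]
    exact mul_le_mul (abs_es_le h.hp H e) (abs_es_le h.hq H e) (abs_nonneg _) (es_nonneg h0 H e)
  have b2 : |vs p H| ≤ TT b 1 H := by
    have := abs_vs_le h.hp H
    rwa [vs_b_eq (b := b)] at this
  have b2' : |∑ e ∈ H, es q H e| ≤ TT b 2 H :=
    ((abs_sum_le_sum_abs _ _).trans (sum_le_sum fun e _ => abs_es_le h.hq H e)).trans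
      (sum_es_one_self h.hb h.hk H)
  have b3 : |∑ e ∈ Hᶜ, es (fd p) H e * es q H e| ≤ 2 * n * TT b 2 H := by
    refine (abs_sum_le_sum_abs _ _).trans ((sum_le_sum (g := fun e => es b H e ^ 2) fun e _ => ?_).trans ?_)
    · rw [abs_mul, sq]
      exact mul_le_mul (abs_es_le h.hdp H e) (abs_es_le h.hq H e) (abs_nonneg _) (es_nonneg h0 H e)
    · exact (sum_le_univ_sum_of_nonneg fun e => sq_nonneg _).trans (sum_es_sq_univ h.hb h.hn H)
  have hT1 := TT_nonneg h.hb 1 H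
  have hT2 := TT_nonneg h.hb 2 H
  have hT4 := TT_nonneg h.hb 4 H
  have hT24 := TT_mono h.hb (show 2 ≤ 4 by norm_num) H
  have hT34 := TT_mono h.hb (show 3 ≤ 4 by norm_num) H
  have hT12 := TT12 h.hb H
  have hμ0 := h.hμ0
  have hμΛ := h.hμΛ
  have hΛ := h.hΛ
  rw [e1]
  calc _ ≤ |-((m : ℝ) + 1) * (∑ e ∈ H, es p H e * es q H e)| + |μ * vs p H * (∑ e ∈ H, es q H e)| +
        |μ * ∑ e ∈ Hᶜ, es (fd p) H e * es q H e| :=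
          (abs_sub _ _).trans (add_le_add_left (abs_add_le _ _) _)
    _ = ((m : ℝ) + 1) * |∑ e ∈ H, es p H e * es q H e| + μ * (|vs p H| * |∑ e ∈ H, es q H e|) +
        μ * |∑ e ∈ Hᶜ, es (fd p) H e * es q H e| := by
        rw [abs_mul, abs_mul, abs_mul, abs_mul, abs_neg, abs_of_nonneg (by positivity : 0 ≤ (m : ℝ) + 1),
          abs_of_nonneg hμ0]; ring
    _ ≤ (Λ * n / 2) * (2 * TT b 3 H) + Λ * (TT b 1 H * TT b 2 H) + Λ * (2 * n * TT b 2 H) := by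
        gcongr
    _ ≤ (Λ * n / 2) * (2 * TT b 4 H) + Λ * (n * TT b 4 H) + Λ * (2 * n * TT b 4 H) := by
        gcongr
    _ = _ := by ring

lemma Hyp.absBc (h : Hyp n m μ Λ b p q) (H : Finset (EdgeIdx n)) (e : EdgeIdx n) :
    |Bc m μ p H e| ≤ 2 * Λ * n * es b H e + Λ * TT b 1 H := by
  have hn : (1 : ℝ) ≤ n := by exact_mod_cast h.hn
  have hm := h.m_le
  have h0 : ∀ k, 0 ≤ b k := fun k => zero_le_one.trans (h.hb k)
  have hμ0 := h.hμ0
  have hμΛ := h.hμΛ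
  have hΛ := h.hΛ
  have c1 := abs_es_le h.hp H e
  have c2 := abs_es_le h.hdp H e
  have c3 := abs_vs_le h.hp H
  rw [vs_b_eq (b := b)] at c3
  have c4 := es_nonneg h0 H e
  have hT1 := TT_nonneg h.hb 1 H
  unfold Bc
  calc _ ≤ |((m : ℝ) + 1) * es p H e| + |μ * vs p H| + |μ * es (fd p) H e| :=
          (abs_sub _ _).trans (add_le_add_left (abs_sub _ _) _)
    _ = ((m : ℝ) + 1) * |es p H e| + μ * |vs p H| + μ * |es (fd p) H e| := by
        rw [abs_mul, abs_mul, abs_mul, abs_of_nonneg (by positivity : 0 ≤ (m : ℝ) + 1),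
          abs_of_nonneg hμ0]
    _ ≤ (Λ * n / 2) * es b H e + Λ * TT b 1 H + Λ * es b H e := by gcongr
    _ = Λ * (n / 2 + 1) * es b H e + Λ * TT b 1 H := by ring
    _ ≤ Λ * (2 * n) * es b H e + Λ * TT b 1 H := by gcongr; linarith
    _ = _ := by ring

lemma Hyp.P3 (h : Hyp n m μ Λ b p q) (H : Finset (EdgeIdx n)) :
    ∑ e ∈ Hᶜ, |Bc m μ p H e| * es b H e ^ 2 ≤ 10 * Λ * n ^ 2 * TT b 4 H := by
  have h0 : ∀ k, 0 ≤ b k := fun k => zero_le_one.trans (h.hb k)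
  have hΛ := h.hΛ
  have hT12 := TT12 h.hb H
  have hT1 := TT_nonneg h.hb 1 H
  have hT34 := TT_mono h.hb (show 3 ≤ 4 by norm_num) H
  calc _ ≤ ∑ e, |Bc m μ p H e| * es b H e ^ 2 :=
        sum_le_univ_sum_of_nonneg fun e => by positivity
    _ ≤ ∑ e, (2 * Λ * n * es b H e + Λ * TT b 1 H) * es b H e ^ 2 := by
        gcongr with e
        exact h.absBc H e
    _ = 2 * Λ * n * (∑ e, es b H e ^ 3) + Λ * TT b 1 H * ∑ e, es b H e ^ 2 := by
        rw [mul_sum, mul_sum, ← sum_add_distrib]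
        exact sum_congr rfl fun e _ => by ring
    _ ≤ 2 * Λ * n * (4 * n * TT b 3 H) + Λ * TT b 1 H * (2 * n * TT b 2 H) := by
        gcongr
        · exact sum_es_cube_univ h.hb h.hn H
        · exact sum_es_sq_univ h.hb h.hn H
    _ = 8 * Λ * n ^ 2 * TT b 3 H + 2 * Λ * n * (TT b 1 H * TT b 2 H) := by ring
    _ ≤ 8 * Λ * n ^ 2 * TT b 4 H + 2 * Λ * n * (n * TT b 4 H) := by gcongr
    _ = _ := by ring

lemma Hyp.P4 (h : Hyp n m μ Λ b p q) (H : Finset (EdgeIdx n)) :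
    ∑ e ∈ Hᶜ, |Bc m μ p H e| * es b H e ≤ 5 * Λ * n ^ 2 * TT b 2 H := by
  have h0 : ∀ k, 0 ≤ b k := fun k => zero_le_one.trans (h.hb k)
  have hΛ := h.hΛ
  have hT11 := TT_sq h.hb 1 H
  norm_num at hT11
  have hT1 := TT_nonneg h.hb 1 H
  calc _ ≤ ∑ e, |Bc m μ p H e| * es b H e :=
        sum_le_univ_sum_of_nonneg fun e => mul_nonneg (abs_nonneg _) (es_nonneg h0 H e)
    _ ≤ ∑ e, (2 * Λ * n * es b H e + Λ * TT b 1 H) * es b H e := by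
        gcongr with e
        · exact es_nonneg h0 H e
        · exact h.absBc H e
    _ = 2 * Λ * n * (∑ e, es b H e ^ 2) + Λ * TT b 1 H * ∑ e, es b H e := by
        rw [mul_sum, mul_sum, ← sum_add_distrib]
        exact sum_congr rfl fun e _ => by ring
    _ ≤ 2 * Λ * n * (2 * n * TT b 2 H) + Λ * TT b 1 H * (n * TT b 1 H) := by
        gcongr
        · exact sum_es_sq_univ h.hb h.hn H
        · exact sum_es_one_univ h.hb h.hn H
    _ = 4 * Λ * n ^ 2 * TT b 2 H + Λ * n * (TT b 1 H ^ 2) := by ring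
    _ ≤ 4 * Λ * n ^ 2 * TT b 2 H + Λ * n * (n * TT b 2 H) := by gcongr
    _ = _ := by ring

end bounds
end GnmCLT

namespace GnmCLT
open Finset

/-- The range of parameters in which our bounds are uniform. -/
structure Reg (Λ : ℝ) (n m : ℕ) : Prop where
  hΛ : 1 ≤ Λ
  hn : 2 * (1 + Λ) ≤ n
  hm : 2 * ((m : ℝ) + 1) ≤ Λ * n

section reg
variable {Λ : ℝ} {n m : ℕ}

lemma Reg.n1 (h : Reg Λ n m) : 1 ≤ n := by
  have h1 := h.hn
  have h2 := h.hΛ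
  have : (1 : ℝ) ≤ n := by linarith
  exact_mod_cast this

lemma Reg.anti (h : Reg Λ n m) {j : ℕ} (hj : j ≤ m) : Reg Λ n j := by
  refine ⟨h.hΛ, h.hn, ?_⟩
  have h1 := h.hm
  have : (j : ℝ) ≤ m := by exact_mod_cast hj
  linarith

lemma Reg.M_ge (h : Reg Λ n m) : (n : ℝ) ^ 2 / 4 ≤ (Fintype.card (EdgeIdx n) : ℝ) - m := by
  rw [card_edge]
  nlinarith [h.hm, h.hn, h.hΛ]

lemma Reg.M_pos (h : Reg Λ n m) : 0 < (Fintype.card (EdgeIdx n) : ℝ) - m := by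
  have h1 := h.M_ge
  have : (1 : ℝ) ≤ n := by exact_mod_cast h.n1
  nlinarith

lemma Reg.m_lt (h : Reg Λ n m) : m < Fintype.card (EdgeIdx n) := by
  have := h.M_pos
  have h2 : (m : ℝ) < Fintype.card (EdgeIdx n) := by linarith
  exact_mod_cast h2

lemma Reg.M_inv (h : Reg Λ n m) : ((Fintype.card (EdgeIdx n) : ℝ) - m)⁻¹ ≤ 4 / (n : ℝ) ^ 2 := by
  have h1 := h.M_ge
  have : (1 : ℝ) ≤ n := by exact_mod_cast h.n1
  rw [inv_le_comm₀ h.M_pos (by positivity), inv_div]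
  exact h1

lemma card_compl_real {H : Finset (EdgeIdx n)} (hH : H.card = m) :
    ((Hᶜ).card : ℝ) = (Fintype.card (EdgeIdx n) : ℝ) - m := by
  rw [card_compl, Nat.cast_sub (card_le_univ H), hH]

lemma moment_aux (h : Reg Λ n m) {B : ℝ} (hB : 1 ≤ B) :
    ∀ j ≤ m, Ex n j (vs (fun k => B ^ k)) ≤ n * (1 + 4 * B / n) ^ j := by
  have hn : (1 : ℝ) ≤ n := by exact_mod_cast h.n1
  intro j
  induction j with
  | zero =>
    intro _
    have : Ex n 0 (vs (fun k => B ^ k)) = Ex n 0 (fun _ => (n : ℝ)) := by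
      refine Ex_congr fun G hG => ?_
      rw [card_eq_zero] at hG
      subst hG
      simp [vs, dg]
    rw [this, Ex_const (Nat.zero_le _)]
    simp
  | succ j ih =>
    intro hj
    have hr := h.anti (show j ≤ m by omega)
    have ih := ih (by omega)
    rw [step' hr.m_lt, ← Ex_smul]
    refine (Ex_mono (F' := fun H => (1 + 4 * B / n) * vs (fun k => B ^ k) H) fun H hH => ?_).trans ?_
    · have e1 : ∑ e ∈ Hᶜ, vs (fun k => B ^ k) (insert e H) ≤
          ((Fintype.card (EdgeIdx n) : ℝ) - j) * vs (fun k => B ^ k) H + B * n * vs (fun k => B ^ k) H := by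
        have a1 : ∑ e ∈ Hᶜ, vs (fun k => B ^ k) (insert e H) =
            ∑ e ∈ Hᶜ, (vs (fun k => B ^ k) H + es (fd fun k => B ^ k) H e) :=
          sum_congr rfl fun e he => vs_insert _ (by simpa using he)
        rw [a1, sum_add_distrib, sum_const, nsmul_eq_mul, card_compl_real hH]
        gcongr
        have hp : ∀ k, 0 ≤ fd (fun k => B ^ k) k := fun k => by
          simp only [fd]; rw [pow_succ]; nlinarith [one_le_pow₀ hB (n := k)]
        refine (sum_le_univ_sum_of_nonneg fun e => es_nonneg hp H e).trans ?_
        rw [sum_es_univ]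
        have : vs (fd fun k => B ^ k) H ≤ B * vs (fun k => B ^ k) H := by
          unfold vs
          rw [mul_sum]
          gcongr with v
          simp only [fd]; rw [pow_succ]; nlinarith [one_le_pow₀ hB (n := dg H v)]
        have h0 := vs_nonneg hp H
        nlinarith
      rw [smul_eq_mul]
      have hv : 0 ≤ vs (fun k => B ^ k) H := vs_nonneg (fun k => by positivity) H
      have hMp := hr.M_pos
      calc _ ≤ ((Fintype.card (EdgeIdx n) : ℝ) - j)⁻¹ *
          (((Fintype.card (EdgeIdx n) : ℝ) - j) * vs (fun k => B ^ k) H + B * n * vs (fun k => B ^ k) H) := by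
            gcongr
        _ = (1 + ((Fintype.card (EdgeIdx n) : ℝ) - j)⁻¹ * (B * n)) * vs (fun k => B ^ k) H := by
            field_simp
        _ ≤ (1 + (4 / (n : ℝ) ^ 2) * (B * n)) * vs (fun k => B ^ k) H := by
            gcongr; exact hr.M_inv
        _ = _ := by field_simp
    · rw [Ex_mul, pow_succ]
      calc _ ≤ (1 + 4 * B / n) * (n * (1 + 4 * B / n) ^ j) := by gcongr
        _ = _ := by ring

lemma moment (h : Reg Λ n m) {B : ℝ} (hB : 1 ≤ B) :
    Ex n m (vs (fun k => B ^ k)) ≤ n * Real.exp (2 * Λ * B) := by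
  have hn : (1 : ℝ) ≤ n := by exact_mod_cast h.n1
  refine (moment_aux h hB m le_rfl).trans ?_
  gcongr
  have h1 : 1 + 4 * B / n ≤ Real.exp (4 * B / n) := by
    have := Real.add_one_le_exp (4 * B / n); linarith
  calc (1 + 4 * B / n) ^ m ≤ Real.exp (4 * B / n) ^ m := by gcongr
    _ = Real.exp (m * (4 * B / n)) := by rw [Real.exp_nat_mul]
    _ ≤ _ := by
      apply Real.exp_le_exp.2
      rw [← mul_div_assoc, div_le_iff₀ (by positivity)]
      nlinarith [h.hm]

lemma moment_TT (h : Reg Λ n m) {C B : ℝ} (hB : 1 ≤ B) (hC : 1 ≤ C) (j : ℕ) :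
    Ex n m (TT (fun k => C * B ^ k) j) ≤ C ^ j * Real.exp (2 * Λ * B ^ j) * n := by
  have : Ex n m (TT (fun k => C * B ^ k) j) = C ^ j * Ex n m (vs (fun k => (B ^ j) ^ k)) := by
    rw [← Ex_mul]
    refine Ex_congr fun G _ => ?_
    simp only [TT, vs]
    rw [mul_sum]
    refine sum_congr rfl fun v _ => ?_
    rw [mul_pow, ← pow_mul, ← pow_mul, mul_comm j]
  rw [this, mul_assoc]
  gcongr
  rw [mul_comm]
  exact moment h (one_le_pow₀ hB)

variable {μ : ℝ} {b g h : ℕ → ℝ}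

lemma lln1 (hr : Reg Λ n m) (hy : Hyp n m μ Λ b (sh h) (fd g)) (hgb : ∀ k, |g k| ≤ b k)
    (hg : ∀ k : ℕ, (k : ℝ) * h k - μ * h (k + 1) = g k) :
    Ex n (m + 1) (fun G => vs g G ^ 2) ≤ 28 * Λ ^ 2 * Ex n m (TT b 4) := by
  have hn : (1 : ℝ) ≤ n := by exact_mod_cast hr.n1
  have hk := key hr.m_lt μ hg (fun G => vs g G)
  have e1 : Ex n (m + 1) (fun G => vs g G ^ 2) = Ex n (m + 1) (fun G => vs g G • vs g G) := by
    refine Ex_congr fun G _ => ?_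
    rw [smul_eq_mul, sq]
  rw [e1, hk, ← Ex_smul, ← Ex_mul]
  refine Ex_mono fun H hH => ?_
  have hΛ := hr.hΛ
  have hT4 := TT_nonneg hy.hb 4 H
  have b1 : ∑ e ∈ Hᶜ, Bc m μ (sh h) H e • vs g (insert e H) ≤ 7 * Λ ^ 2 * n ^ 2 * TT b 4 H := by
    have a1 : ∑ e ∈ Hᶜ, Bc m μ (sh h) H e • vs g (insert e H) =
        vs g H * (∑ e ∈ Hᶜ, Bc m μ (sh h) H e) + ∑ e ∈ Hᶜ, Bc m μ (sh h) H e * es (fd g) H e := by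
      rw [mul_sum, ← sum_add_distrib]
      refine sum_congr rfl fun e he => ?_
      rw [vs_insert _ (by simpa using he), smul_eq_mul]; ring
    have a2 : ∑ e ∈ Hᶜ, Bc m μ (sh h) H e * es (fd g) H e ≤ 5 * Λ * n ^ 2 * TT b 2 H := by
      refine le_trans (sum_le_sum fun e _ => ?_) (hy.P4 H)
      refine (le_abs_self _).trans ?_
      rw [abs_mul]
      gcongr
      exact abs_es_le hy.hq H e
    have a3 : vs g H * (∑ e ∈ Hᶜ, Bc m μ (sh h) H e) ≤ TT b 1 H * (2 * Λ ^ 2 * n * TT b 2 H) := by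
      refine (le_abs_self _).trans ?_
      rw [abs_mul]
      have := abs_vs_le hgb H
      rw [vs_b_eq (b := b)] at this
      exact mul_le_mul this (hy.P1 hH) (abs_nonneg _) (TT_nonneg hy.hb 1 H)
    have hT24 := TT_mono hy.hb (show 2 ≤ 4 by norm_num) H
    have hT12 := TT12 hy.hb H
    have hT2 := TT_nonneg hy.hb 2 H
    calc _ ≤ TT b 1 H * (2 * Λ ^ 2 * n * TT b 2 H) + 5 * Λ * n ^ 2 * TT b 2 H := by
          rw [a1]; exact add_le_add a3 a2
      _ = 2 * Λ ^ 2 * n * (TT b 1 H * TT b 2 H) + 5 * Λ * n ^ 2 * TT b 2 H := by ring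
      _ ≤ 2 * Λ ^ 2 * n * (n * TT b 4 H) + 5 * (Λ ^ 2) * n ^ 2 * TT b 4 H := by
          gcongr; nlinarith
      _ = _ := by ring
  rw [smul_eq_mul]
  have hMp := hr.M_pos
  calc _ ≤ ((Fintype.card (EdgeIdx n) : ℝ) - m)⁻¹ * (7 * Λ ^ 2 * n ^ 2 * TT b 4 H) := by gcongr
    _ ≤ (4 / (n : ℝ) ^ 2) * (7 * Λ ^ 2 * n ^ 2 * TT b 4 H) := by
        gcongr; exact hr.M_inv
    _ = _ := by field_simp; ring

lemma lln2 (hr : Reg Λ n m) (hy : Hyp n m μ Λ b (sh h) (fd g)) (hgb : ∀ k, |g k| ≤ b k)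
    (hg : ∀ k : ℕ, (k : ℝ) * h k - μ * h (k + 1) = g k) :
    Ex n m (fun G => vs g G ^ 2) ≤ (56 * Λ ^ 2 + 16) * Ex n m (TT b 4) := by
  have hn : (1 : ℝ) ≤ n := by exact_mod_cast hr.n1
  have h1 := lln1 hr hy hgb hg
  rw [step' hr.m_lt, ← Ex_smul] at h1
  have h2 : Ex n m (fun G => vs g G ^ 2) ≤
      2 * Ex n m (fun H => ((Fintype.card (EdgeIdx n) : ℝ) - m)⁻¹ • ∑ e ∈ Hᶜ, vs g (insert e H) ^ 2)
      + 16 * Ex n m (TT b 4) := by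
    rw [← Ex_mul, ← Ex_mul, ← Ex_add]
    refine Ex_mono fun H hH => ?_
    have hMp := hr.M_pos
    have a1 : ((Fintype.card (EdgeIdx n) : ℝ) - m) * vs g H ^ 2 ≤
        2 * (∑ e ∈ Hᶜ, vs g (insert e H) ^ 2) + 2 * (2 * n * TT b 2 H) := by
      have : ∑ e ∈ Hᶜ, es (fd g) H e ^ 2 ≤ 2 * n * TT b 2 H := by
        refine (sum_le_univ_sum_of_nonneg fun e => sq_nonneg _).trans
          (le_trans (sum_le_sum fun e _ => ?_) (sum_es_sq_univ hy.hb hy.hn H))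
        rw [← sq_abs (es (fd g) H e)]
        gcongr
        exact abs_es_le hy.hq H e
      calc _ = ∑ e ∈ Hᶜ, vs g H ^ 2 := by rw [sum_const, nsmul_eq_mul, card_compl_real hH]
        _ ≤ ∑ e ∈ Hᶜ, (2 * vs g (insert e H) ^ 2 + 2 * es (fd g) H e ^ 2) := by
            refine sum_le_sum fun e he => ?_
            rw [vs_insert _ (by simpa using he)]
            nlinarith [sq_nonneg (vs g H + 2 * es (fd g) H e)]
        _ = 2 * (∑ e ∈ Hᶜ, vs g (insert e H) ^ 2) + 2 * ∑ e ∈ Hᶜ, es (fd g) H e ^ 2 := by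
            rw [sum_add_distrib, mul_sum, mul_sum]
        _ ≤ _ := by gcongr
    have hT24 := TT_mono hy.hb (show 2 ≤ 4 by norm_num) H
    have hT2 := TT_nonneg hy.hb 2 H
    have hT4 := TT_nonneg hy.hb 4 H
    have a2 : vs g H ^ 2 ≤ ((Fintype.card (EdgeIdx n) : ℝ) - m)⁻¹ *
        (2 * (∑ e ∈ Hᶜ, vs g (insert e H) ^ 2) + 2 * (2 * n * TT b 2 H)) := by
      rw [le_inv_mul_iff₀ hMp]; exact a1
    have a3 : ((Fintype.card (EdgeIdx n) : ℝ) - m)⁻¹ * (2 * (2 * n * TT b 2 H)) ≤ 16 * TT b 4 H := by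
      calc _ ≤ (4 / (n : ℝ) ^ 2) * (2 * (2 * n * TT b 4 H)) := by
            gcongr; exact hr.M_inv
        _ = (16 * TT b 4 H) / n := by field_simp; ring
        _ ≤ _ := div_le_self (by positivity) hn
    rw [smul_eq_mul]
    linarith
  linarith

end reg

lemma stein_all (Λ C B : ℝ) (hC : 1 ≤ C) (hB : 2 ≤ B) :
    ∃ C' : ℝ, 1 ≤ C' ∧ ∀ μ : ℝ, 0 ≤ μ → μ ≤ Λ → ∀ ψ : ℕ → ℝ, (∀ k, |ψ k| ≤ C * B ^ k) →
      ∃ g h : ℕ → ℝ, (∀ k, g k = ψ k - pm μ ψ) ∧ EB h ∧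
        (∀ k : ℕ, (k : ℝ) * h k - μ * h (k + 1) = g k) ∧
        (∀ k, |g k| ≤ C' * B ^ k) ∧ (∀ k, |sh h k| ≤ C' * B ^ k) ∧
        (∀ k, |fd (sh h) k| ≤ C' * B ^ k) ∧ (∀ k, |fd g k| ≤ C' * B ^ k) := by
  set C1 := C * (1 + Real.exp (B * Λ)) with hC1
  set C2 := C1 * Real.exp (B * Λ) with hC2
  have hB0 : 0 ≤ B := by linarith
  have hE : 0 < Real.exp (B * Λ) := Real.exp_pos _
  have hC1p : 1 ≤ C1 := by nlinarith
  refine ⟨max (C1 * (B + 1)) (C2 * (B ^ 2 + B)), le_max_of_le_left (by nlinarith), ?_⟩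
  intro μ hμ0 hμΛ ψ hψ
  have hpm := abs_pm_le hψ hμ0
  have hgb : ∀ k, |ψ k - pm μ ψ| ≤ C1 * B ^ k := by
    intro k
    have h1 : |pm μ ψ| ≤ C * Real.exp (B * Λ) := by
      refine hpm.trans ?_
      gcongr
      nlinarith
    have h2 : 1 ≤ B ^ k := one_le_pow₀ (by linarith)
    calc |ψ k - pm μ ψ| ≤ |ψ k| + |pm μ ψ| := abs_sub _ _
      _ ≤ C * B ^ k + C * Real.exp (B * Λ) * B ^ k :=
        add_le_add (hψ k) (h1.trans (le_mul_of_one_le_right (by positivity) h2))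
      _ = _ := by rw [hC1]; ring
  have hhb : ∀ k, |stein μ (fun k => ψ k - pm μ ψ) k| ≤ C2 * B ^ k := by
    intro k
    refine (stein_bound hμ0 hB0 (by linarith) hgb k).trans ?_
    rw [hC2]
    gcongr
  have hEBψ : EB ψ := ⟨C, B, hψ⟩
  have hC2p : 0 ≤ C2 := by rw [hC2]; positivity
  refine ⟨fun k => ψ k - pm μ ψ, stein μ (fun k => ψ k - pm μ ψ), fun k => rfl, ⟨C2, B, hhb⟩,
    stein_eq hμ0 ⟨C1, B, hgb⟩ ?_, ?_, ?_, ?_, ?_⟩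
  · rw [pm_sub hμ0 hEBψ (EB.const _), pm_const, sub_self]
  · intro k
    refine (hgb k).trans ?_
    gcongr
    exact le_max_of_le_left (by nlinarith)
  · intro k
    refine (hhb (k + 1)).trans ?_
    calc C2 * B ^ (k + 1) = (C2 * B) * B ^ k := by rw [pow_succ]; ring
      _ ≤ _ := by
        gcongr
        refine le_max_of_le_right ?_
        gcongr
        nlinarith
  · intro k
    calc |fd (sh (stein μ fun k => ψ k - pm μ ψ)) k| ≤ C2 * B ^ (k + 1 + 1) + C2 * B ^ (k + 1) :=
          (abs_sub _ _).trans (add_le_add (hhb _) (hhb _))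
      _ = (C2 * (B ^ 2 + B)) * B ^ k := by ring
      _ ≤ _ := by
        gcongr
        exact le_max_right _ _
  · intro k
    calc |fd (fun k => ψ k - pm μ ψ) k| ≤ C1 * B ^ (k + 1) + C1 * B ^ k :=
          (abs_sub _ _).trans (add_le_add (hgb _) (hgb _))
      _ = (C1 * (B + 1)) * B ^ k := by ring
      _ ≤ _ := by
        gcongr
        exact le_max_left _ _

/-- the mean degree parameter attached to `m + 1` edges -/
def mu (n m : ℕ) : ℝ := 2 * ((m : ℝ) + 1) / n

lemma Reg.mu_le {Λ : ℝ} {n m : ℕ} (h : Reg Λ n m) : mu n m ≤ Λ := by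
  have hn : (1 : ℝ) ≤ n := by exact_mod_cast h.n1
  unfold mu
  rw [div_le_iff₀ (by positivity)]
  exact h.hm

lemma Reg.mu_pos {Λ : ℝ} {n m : ℕ} (h : Reg Λ n m) : 0 < mu n m := by
  have hn : (1 : ℝ) ≤ n := by exact_mod_cast h.n1
  unfold mu
  positivity

lemma mk_hyp {Λ : ℝ} {n m : ℕ} (h : Reg Λ n m) {C B : ℝ} (hC : 1 ≤ C) (hB : 2 ≤ B) {p q : ℕ → ℝ}
    (hp : ∀ k, |p k| ≤ C * B ^ k) (hdp : ∀ k, |fd p k| ≤ C * B ^ k) (hq : ∀ k, |q k| ≤ C * B ^ k) :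
    Hyp n m (mu n m) Λ (fun k => C * B ^ k) p q := by
  have hn : (1 : ℝ) ≤ n := by exact_mod_cast h.n1
  refine ⟨h.n1, ?_, ?_, ?_, h.mu_pos.le, h.mu_le, h.hΛ, hp, hdp, hq⟩
  · intro k
    have : 1 ≤ B ^ k := one_le_pow₀ (by linarith)
    show 1 ≤ C * B ^ k
    nlinarith
  · intro k
    have h1 : (k : ℝ) ≤ 2 ^ k := by exact_mod_cast k.lt_two_pow_self.le
    have h2 : (2 : ℝ) ^ k ≤ B ^ k := by gcongr
    have h3 : 0 ≤ B ^ k := by positivity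
    show (k : ℝ) ≤ C * B ^ k
    nlinarith
  · unfold mu; field_simp

lemma lln (Λ C B : ℝ) (hC : 1 ≤ C) (hB : 2 ≤ B) :
    ∃ L : ℝ, 0 ≤ L ∧ ∀ n m : ℕ, Reg Λ n m → ∀ ψ : ℕ → ℝ, (∀ k, |ψ k| ≤ C * B ^ k) →
      Ex n m (fun G => (vs ψ G - n * pm (mu n m) ψ) ^ 2) ≤ L * n := by
  obtain ⟨C', hC', hst⟩ := stein_all Λ C B hC hB
  refine ⟨(56 * Λ ^ 2 + 16) * (C' ^ 4 * Real.exp (2 * Λ * B ^ 4)), by positivity, ?_⟩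
  intro n m hr ψ hψ
  obtain ⟨g, h, hgd, -, heq, hg, hsh, hfsh, hfg⟩ := hst (mu n m) hr.mu_pos.le hr.mu_le ψ hψ
  have hy := mk_hyp hr hC' hB hsh hfsh hfg
  have h1 := lln2 hr hy hg heq
  have h2 := moment_TT hr (by linarith : 1 ≤ B) hC' 4
  have h3 : Ex n m (fun G => (vs ψ G - n * pm (mu n m) ψ) ^ 2) = Ex n m (fun G => vs g G ^ 2) := by
    refine Ex_congr fun G _ => ?_
    congr 1
    simp [vs, hgd]
  rw [h3, mul_assoc]
  refine h1.trans ?_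
  gcongr

end GnmCLT

namespace GnmCLT
open Finset Complex

lemma cexp_bd1 (x : ℝ) : ‖cexp (I * x) - 1‖ ≤ |x| := by
  simpa using Real.norm_exp_I_mul_ofReal_sub_one_le (x := x)

lemma cexp_norm (x : ℝ) : ‖cexp (I * x)‖ = 1 := by
  rw [mul_comm]; exact Complex.norm_exp_ofReal_mul_I x

lemma cexp_bd2 (x : ℝ) : ‖cexp (I * x) - 1 - I * x‖ ≤ 3 * x ^ 2 := by
  have hx : ‖I * (x : ℂ)‖ = |x| := by simp
  by_cases h : |x| ≤ 1
  · have := Complex.norm_exp_sub_one_sub_id_le (x := I * x) (by rw [hx]; exact h)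
    rw [hx, sq_abs] at this
    nlinarith [sq_nonneg x]
  · have h1 := norm_sub_le (cexp (I * x) - 1) (I * x)
    have h2 := cexp_bd1 x
    rw [hx] at h1
    rw [← sq_abs]
    nlinarith

/-- the characteristic weight -/
def KK {n : ℕ} (s : ℝ) (g : ℕ → ℝ) (G : Finset (EdgeIdx n)) : ℂ := cexp (I * ((s * vs g G : ℝ) : ℂ))

/-- empirical covariance -/
def XX {n : ℕ} (p q : ℕ → ℝ) (G : Finset (EdgeIdx n)) : ℝ :=
  vs (fun k => p k * q k) G - vs p G * vs q G / n

section cf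
variable {n m : ℕ} {μ Λ s : ℝ} {b g h p q : ℕ → ℝ}

lemma KK_norm (G : Finset (EdgeIdx n)) : ‖KK s g G‖ = 1 := cexp_norm _

lemma KK_insert {H : Finset (EdgeIdx n)} {e : EdgeIdx n} (he : e ∉ H) :
    KK s g (insert e H) = KK s g H * cexp (I * ((s * es (fd g) H e : ℝ) : ℂ)) := by
  unfold KK
  rw [← Complex.exp_add, vs_insert _ he]
  congr 1
  push_cast
  ring

lemma t1_pt (hy : Hyp n m μ Λ b p (fd g)) {H : Finset (EdgeIdx n)} (hH : H.card = m) :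
    ‖∑ e ∈ Hᶜ, Bc m μ p H e • KK s g (insert e H) -
      ((((m : ℝ) + 1) * ((n : ℝ) - 2) : ℝ) : ℂ) * (I * s * (KK s g H * (XX p (fd g) H : ℂ)))‖ ≤
      2 * Λ ^ 2 * n * TT b 2 H + |s| * (4 * Λ * n * TT b 4 H) + 3 * s ^ 2 * (10 * Λ * n ^ 2 * TT b 4 H) := by
  set r : EdgeIdx n → ℂ := fun e => cexp (I * ((s * es (fd g) H e : ℝ) : ℂ)) - 1 -
    I * ((s * es (fd g) H e : ℝ) : ℂ) with hr
  have e1 : ∑ e ∈ Hᶜ, Bc m μ p H e • KK s g (insert e H) = KK s g H *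
      (((∑ e ∈ Hᶜ, Bc m μ p H e : ℝ) : ℂ) + I * s * ((∑ e ∈ Hᶜ, Bc m μ p H e * es (fd g) H e : ℝ) : ℂ)
        + ∑ e ∈ Hᶜ, (Bc m μ p H e : ℂ) * r e) := by
    push_cast
    rw [mul_sum (a := I * (s : ℂ)), ← sum_add_distrib, ← sum_add_distrib, mul_sum]
    refine sum_congr rfl fun e he => ?_
    rw [KK_insert (by simpa using he), Complex.real_smul, hr]
    push_cast
    ring
  have e2 : ∑ e ∈ Hᶜ, Bc m μ p H e • KK s g (insert e H) -
      ((((m : ℝ) + 1) * ((n : ℝ) - 2) : ℝ) : ℂ) * (I * s * (KK s g H * (XX p (fd g) H : ℂ))) =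
      KK s g H * (((∑ e ∈ Hᶜ, Bc m μ p H e : ℝ) : ℂ) + I * s *
        ((∑ e ∈ Hᶜ, Bc m μ p H e * es (fd g) H e - ((m : ℝ) + 1) * ((n : ℝ) - 2) * XX p (fd g) H : ℝ) : ℂ)
        + ∑ e ∈ Hᶜ, (Bc m μ p H e : ℂ) * r e) := by
    rw [e1]; push_cast; ring
  rw [e2, norm_mul, KK_norm, one_mul]
  refine (norm_add₃_le).trans ?_
  have b1 := hy.P1 hH
  have b2 := hy.P2 hH
  have b3 := hy.P3 H
  refine add_le_add (add_le_add ?_ ?_) ?_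
  · rw [Complex.norm_real, Real.norm_eq_abs]; exact b1
  · rw [norm_mul, norm_mul, Complex.norm_I, one_mul, Complex.norm_real, Complex.norm_real,
      Real.norm_eq_abs, Real.norm_eq_abs]
    gcongr
    exact b2
  · calc _ ≤ ∑ e ∈ Hᶜ, ‖(Bc m μ p H e : ℂ) * r e‖ := norm_sum_le _ _
      _ ≤ ∑ e ∈ Hᶜ, 3 * s ^ 2 * (|Bc m μ p H e| * es b H e ^ 2) := by
        refine sum_le_sum fun e _ => ?_
        rw [norm_mul, Complex.norm_real, Real.norm_eq_abs]
        have c1 : ‖r e‖ ≤ 3 * (s * es (fd g) H e) ^ 2 := cexp_bd2 _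
        have c2 : es (fd g) H e ^ 2 ≤ es b H e ^ 2 := by
          rw [← sq_abs (es (fd g) H e)]
          gcongr
          exact abs_es_le hy.hq H e
        calc _ ≤ |Bc m μ p H e| * (3 * (s * es (fd g) H e) ^ 2) := by gcongr
          _ = 3 * s ^ 2 * (|Bc m μ p H e| * es (fd g) H e ^ 2) := by ring
          _ ≤ _ := by gcongr
      _ ≤ _ := by
        rw [← mul_sum]
        gcongr

lemma alpha_bd (hr : Reg Λ n m) :
    |((m : ℝ) + 1) * ((n : ℝ) - 2) / ((Fintype.card (EdgeIdx n) : ℝ) - m) - mu n m| ≤ 2 * Λ ^ 2 / n := by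
  have hn : (1 : ℝ) ≤ n := by exact_mod_cast hr.n1
  have hMp := hr.M_pos
  have hMg := hr.M_ge
  set M := (Fintype.card (EdgeIdx n) : ℝ) - m with hM
  have hM2 : M = n * (n - 1) / 2 - m := by rw [hM, card_edge]
  have e : ((m : ℝ) + 1) * ((n : ℝ) - 2) / M - mu n m = ((m : ℝ) + 1) * (2 * m - n) / (n * M) := by
    unfold mu
    field_simp
    rw [hM2]; ring
  rw [e, abs_div, abs_mul, abs_of_pos (by positivity : 0 < (n : ℝ) * M),
    abs_of_pos (by positivity : 0 < (m : ℝ) + 1), div_le_div_iff₀ (by positivity) (by positivity)]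
  have hm := hr.hm
  have hΛ := hr.hΛ
  have h1 : |2 * (m : ℝ) - n| ≤ Λ * n := by
    rw [abs_le]; constructor <;> nlinarith [Nat.cast_nonneg (α := ℝ) m]
  calc ((m : ℝ) + 1) * |2 * (m : ℝ) - n| * n ≤ (Λ * n / 2) * (Λ * n) * n := by
        gcongr; linarith
    _ = 2 * Λ ^ 2 * (n * (n ^ 2 / 4)) := by ring
    _ ≤ _ := by gcongr

lemma t4 (hr : Reg Λ n m) (hy : Hyp n m μ Λ b p (fd g)) :
    ‖Ex n m (KK s g) - Ex n (m + 1) (KK s g)‖ ≤ 4 * |s| / n * Ex n m (TT b 1) := by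
  have hn : (1 : ℝ) ≤ n := by exact_mod_cast hr.n1
  have hMp := hr.M_pos
  rw [step' hr.m_lt, ← Ex_smul, ← Ex_sub, ← Ex_mul]
  refine norm_Ex_le_of fun H hH => ?_
  have hT := TT_nonneg hy.hb 1 H
  have e1 : KK s g H - ((Fintype.card (EdgeIdx n) : ℝ) - m)⁻¹ • ∑ e ∈ Hᶜ, KK s g (insert e H) =
      ((Fintype.card (EdgeIdx n) : ℝ) - m)⁻¹ • ∑ e ∈ Hᶜ, (KK s g H - KK s g (insert e H)) := by
    rw [sum_sub_distrib, smul_sub, sum_const, ← Nat.cast_smul_eq_nsmul ℝ, smul_smul, card_compl_real hH,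
      inv_mul_cancel₀ hMp.ne', one_smul]
  rw [e1, norm_smul, Real.norm_of_nonneg (inv_nonneg.2 hMp.le)]
  have e2 : ‖∑ e ∈ Hᶜ, (KK s g H - KK s g (insert e H))‖ ≤ |s| * (n * TT b 1 H) := by
    calc _ ≤ ∑ e ∈ Hᶜ, ‖KK s g H - KK s g (insert e H)‖ := norm_sum_le _ _
      _ ≤ ∑ e ∈ Hᶜ, |s| * es b H e := by
        refine sum_le_sum fun e he => ?_
        rw [KK_insert (by simpa using he), ← mul_one_sub, norm_mul, KK_norm, one_mul, norm_sub_rev]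
        refine (cexp_bd1 _).trans ?_
        rw [abs_mul]
        gcongr
        exact abs_es_le hy.hq H e
      _ ≤ ∑ e, |s| * es b H e := sum_le_univ_sum_of_nonneg fun e =>
          mul_nonneg (abs_nonneg _) (es_nonneg (fun k => zero_le_one.trans (hy.hb k)) H e)
      _ ≤ _ := by
        rw [← mul_sum]
        gcongr
        exact sum_es_one_univ hy.hb hy.hn H
  calc _ ≤ (4 / (n : ℝ) ^ 2) * (|s| * (n * TT b 1 H)) := by
        gcongr
        exact hr.M_inv
    _ = _ := by field_simp

lemma XX_bd (hb : ∀ k, 1 ≤ b k) (hn : 1 ≤ n) (hp : ∀ k, |p k| ≤ b k) (hq : ∀ k, |q k| ≤ b k)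
    (H : Finset (EdgeIdx n)) : |XX p q H| ≤ 2 * TT b 2 H := by
  have hn : (1 : ℝ) ≤ n := by exact_mod_cast hn
  have h0 : ∀ k, 0 ≤ b k := fun k => zero_le_one.trans (hb k)
  have h1 : |vs (fun k => p k * q k) H| ≤ TT b 2 H := by
    refine abs_vs_le (fun k => ?_) H
    rw [abs_mul, sq]
    exact mul_le_mul (hp k) (hq k) (abs_nonneg _) (h0 k)
  have h2 : |vs p H * vs q H / n| ≤ TT b 2 H := by
    rw [abs_div, abs_mul, abs_of_pos (by positivity : (0 : ℝ) < n), div_le_iff₀ (by positivity)]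
    have a1 := abs_vs_le hp H
    have a2 := abs_vs_le hq H
    rw [vs_b_eq (b := b)] at a1 a2
    have a3 := TT_sq hb 1 H
    norm_num at a3
    calc _ ≤ TT b 1 H * TT b 1 H := mul_le_mul a1 a2 (abs_nonneg _) (TT_nonneg hb 1 H)
      _ ≤ _ := by nlinarith
  unfold XX
  refine (abs_sub _ _).trans ?_
  linarith

lemma amgm {x y w : ℝ} (hw : 0 < w) : |x| * y ≤ (x ^ 2 / w + w * y ^ 2) / 2 := by
  have : 0 ≤ (|x| - w * y) ^ 2 / w := by positivity
  have e : (|x| - w * y) ^ 2 / w = x ^ 2 / w - 2 * (|x| * y) + w * y ^ 2 := by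
    rw [← sq_abs x]; field_simp; ring
  linarith

lemma t3_pt (hb : ∀ k, 1 ≤ b k) (hn : 1 ≤ n) (hq : ∀ k, |q k| ≤ b k)
    {R c1 c2 c3 : ℝ} (hR : 0 ≤ R) (hc2 : |c2| ≤ R) (H : Finset (EdgeIdx n)) :
    |XX p q H - n * (c1 - c2 * c3)| ≤
      (1 / (2 * √n)) * (vs (fun k => p k * q k) H - n * c1) ^ 2 +
      (1 / (2 * √n)) * (vs p H - n * c2) ^ 2 + (R / (2 * √n)) * (vs q H - n * c3) ^ 2 +
      (1 / (2 * √n)) * TT b 2 H + √n * (1 + R) / 2 := by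
  have hn : (1 : ℝ) ≤ n := by exact_mod_cast hn
  set w := √(n : ℝ) with hw
  have hwp : 0 < w := Real.sqrt_pos.2 (by linarith)
  have hw2 : w ^ 2 = n := Real.sq_sqrt (by linarith)
  set x1 := vs (fun k => p k * q k) H - n * c1 with hx1
  set x2 := vs p H - n * c2 with hx2
  set x3 := vs q H - n * c3 with hx3
  have e : XX p q H - n * (c1 - c2 * c3) = x1 - x2 * (vs q H / n) - c2 * x3 := by
    rw [hx1, hx2, hx3, XX]
    field_simp
    ring
  have a1 : |x1| ≤ (x1 ^ 2 / w + w) / 2 := by simpa using amgm (x := x1) (y := 1) hwp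
  have a3 : |x3| ≤ (x3 ^ 2 / w + w) / 2 := by simpa using amgm (x := x3) (y := 1) hwp
  have a2 := amgm (x := x2) (y := |vs q H / n|) hwp
  have a4 : w * |vs q H / n| ^ 2 ≤ TT b 2 H / w := by
    rw [sq_abs, div_pow, le_div_iff₀ hwp]
    have b1 := abs_vs_le hq H
    rw [vs_b_eq (b := b)] at b1
    have b2 := TT_sq hb 1 H
    norm_num at b2
    have b3 : vs q H ^ 2 ≤ TT b 1 H ^ 2 := by rw [← sq_abs]; gcongr
    calc w * (vs q H ^ 2 / n ^ 2) * w = vs q H ^ 2 / n := by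
          rw [mul_right_comm, ← sq, hw2]; field_simp
      _ ≤ _ := by rw [div_le_iff₀ (by positivity)]; linarith
  rw [e]
  calc _ ≤ |x1| + |x2| * |vs q H / n| + |c2| * |x3| := by
        rw [← abs_mul, ← abs_mul]
        refine (abs_sub _ _).trans (add_le_add_left (abs_sub _ _) _)
    _ ≤ (x1 ^ 2 / w + w) / 2 + (x2 ^ 2 / w + TT b 2 H / w) / 2 + R * ((x3 ^ 2 / w + w) / 2) := by
        refine add_le_add (add_le_add a1 ?_) ?_
        · linarith
        · exact mul_le_mul hc2 a3 (abs_nonneg _) hR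
    _ = _ := by field_simp; ring

end cf

lemma t3 (Λ C B : ℝ) (hC : 1 ≤ C) (hB : 2 ≤ B) :
    ∃ Q : ℝ, 0 ≤ Q ∧ ∀ n m : ℕ, Reg Λ n m → ∀ p q : ℕ → ℝ, (∀ k, |p k| ≤ C * B ^ k) →
      (∀ k, |q k| ≤ C * B ^ k) →
      |pm (mu n m) (fun k => p k * q k) - pm (mu n m) p * pm (mu n m) q| ≤ Q ∧
      Ex n m (fun G => |XX p q G - n * (pm (mu n m) (fun k => p k * q k) - pm (mu n m) p * pm (mu n m) q)|)
        ≤ Q * √n := by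
  obtain ⟨L1, hL1, hl1⟩ := lln Λ C B hC hB
  obtain ⟨L2, hL2, hl2⟩ := lln Λ (C ^ 2) (B ^ 2) (one_le_pow₀ hC) (by nlinarith)
  set R := C * Real.exp (B * Λ) with hR
  set R2 := C ^ 2 * Real.exp (B ^ 2 * Λ) with hR2
  set D := C ^ 2 * Real.exp (2 * Λ * B ^ 2) with hD
  have hRp : 0 ≤ R := by positivity
  have hR2p : 0 ≤ R2 := by positivity
  have hDp : 0 ≤ D := by positivity
  refine ⟨max (R2 + R * R) (L2 / 2 + L1 / 2 + R * L1 / 2 + D / 2 + (1 + R) / 2),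
    le_max_of_le_left (by positivity), ?_⟩
  intro n m hr p q hp hq
  have hn : (1 : ℝ) ≤ n := by exact_mod_cast hr.n1
  have hμ0 := hr.mu_pos.le
  have hμΛ := hr.mu_le
  have hexp : ∀ A : ℝ, 0 ≤ A → Real.exp (A * mu n m - mu n m) ≤ Real.exp (A * Λ) := by
    intro A hA
    apply Real.exp_le_exp.2
    nlinarith
  have hpmR : ∀ ψ : ℕ → ℝ, (∀ k, |ψ k| ≤ C * B ^ k) → |pm (mu n m) ψ| ≤ R := by
    intro ψ hψ
    refine (abs_pm_le hψ hμ0).trans ?_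
    rw [hR]
    gcongr
    exact Real.exp_le_exp.1 (hexp B (by linarith))
  have hpq : ∀ k, |p k * q k| ≤ C ^ 2 * (B ^ 2) ^ k := by
    intro k
    rw [abs_mul]
    calc _ ≤ (C * B ^ k) * (C * B ^ k) := by
          gcongr
          · exact hp k
          · exact hq k
      _ = _ := by ring
  have hpq2 : |pm (mu n m) (fun k => p k * q k)| ≤ R2 := by
    refine (abs_pm_le hpq hμ0).trans ?_
    rw [hR2]
    gcongr
    exact Real.exp_le_exp.1 (hexp (B ^ 2) (by positivity))
  constructor
  · refine le_max_of_le_left ((abs_sub _ _).trans (add_le_add hpq2 ?_))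
    rw [abs_mul]
    gcongr
    · exact hpmR p hp
    · exact hpmR q hq
  · have hb : ∀ k : ℕ, 1 ≤ C * B ^ k := fun k => by
      have : 1 ≤ B ^ k := one_le_pow₀ (by linarith)
      nlinarith
    have h1 := Ex_mono (n := n) (m := m) fun H _ =>
      t3_pt hb hr.n1 hq (p := p) (c1 := pm (mu n m) (fun k => p k * q k)) (c3 := pm (mu n m) q)
        hRp (hpmR p hp) H
    refine h1.trans ?_
    rw [Ex_add, Ex_add, Ex_add, Ex_add, Ex_mul, Ex_mul, Ex_mul, Ex_mul, Ex_const hr.m_lt.le]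
    have i1 := hl2 n m hr (fun k => p k * q k) hpq
    have i2 := hl1 n m hr p hp
    have i3 := hl1 n m hr q hq
    have i4 := moment_TT hr (by linarith : 1 ≤ B) hC 2
    have hwp : 0 < √(n : ℝ) := Real.sqrt_pos.2 (by linarith)
    have hw2 : √(n : ℝ) ^ 2 = n := Real.sq_sqrt (by linarith)
    calc _ ≤ 1 / (2 * √n) * (L2 * n) + 1 / (2 * √n) * (L1 * n) + R / (2 * √n) * (L1 * n)
          + 1 / (2 * √n) * (D * n) + √n * (1 + R) / 2 := by gcongr
      _ = (L2 / 2 + L1 / 2 + R * L1 / 2 + D / 2 + (1 + R) / 2) * √n := by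
          rw [← hw2, Real.sqrt_sq hwp.le]; field_simp
      _ ≤ _ := by
          gcongr
          exact le_max_right _ _

lemma Ex_ofReal_smul {n m : ℕ} (c : ℝ) (F : Finset (EdgeIdx n) → ℂ) :
    c • Ex n m F = (c : ℂ) * Ex n m F := Complex.real_smul

lemma cf_estimate (Λ C B : ℝ) (hC : 1 ≤ C) (hB : 2 ≤ B) :
    ∃ K' : ℝ, 0 ≤ K' ∧ ∀ n m : ℕ, Reg Λ n m → ∀ f : ℕ → ℝ, (∀ k, |f k| ≤ C * B ^ k) → ∀ s : ℝ,
      ‖Ex n (m + 1) (fun G => vs (fun k => f k - pm (mu n m) f) G • KK s (fun k => f k - pm (mu n m) f) G)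
        - I * s * n * VV (mu n m) f * Ex n (m + 1) (KK s (fun k => f k - pm (mu n m) f))‖
      ≤ K' * (1 + |s| * √n + s ^ 2 * n) := by
  obtain ⟨C', hC', hst⟩ := stein_all Λ C B hC hB
  obtain ⟨Q, hQ, ht3⟩ := t3 Λ C' B hC' hB
  set D := C' ^ 4 * Real.exp (2 * Λ * B ^ 4) with hD
  have hDp : 0 ≤ D := by positivity
  refine ⟨8 * Λ ^ 2 * D + (16 * |Λ| * D + 4 * Λ ^ 2 * D + |Λ| * Q) + (120 * |Λ| * D + 4 * |Λ| * Q * D),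
    by positivity, ?_⟩
  intro n m hr f hf s
  obtain ⟨g, h, hgd, hEBh, heq, hg, hsh, hfsh, hfg⟩ := hst (mu n m) hr.mu_pos.le hr.mu_le f hf
  have hgf : (fun k => f k - pm (mu n m) f) = g := by ext k; rw [hgd]
  rw [hgf]
  have hy := mk_hyp hr hC' hB hsh hfsh hfg
  set b : ℕ → ℝ := fun k => C' * B ^ k with hb
  set μ := mu n m with hμ
  have hfdg : fd g = fd f := by
    ext k; simp [fd, hgd]
  obtain ⟨hV, hX⟩ := ht3 n m hr (sh h) (fd g) hsh hfg
  rw [← hμ] at hV hX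
  set V0 := pm μ (fun k => sh h k * fd g k) - pm μ (sh h) * pm μ (fd g) with hV0
  have hVV : VV μ f = μ * V0 := by
    rw [hV0, hfdg]
    exact (var_identity hr.mu_pos ⟨C, B, hf⟩ hEBh (fun k => by rw [heq, hgd])).symm
  have hn : (1 : ℝ) ≤ n := by exact_mod_cast hr.n1
  have hΛ := hr.hΛ
  have hμ0 : 0 < μ := hr.mu_pos
  have hμΛ : μ ≤ Λ := hr.mu_le
  have hMp := hr.M_pos
  have hMi := hr.M_inv
  have hal := alpha_bd hr
  set M := (Fintype.card (EdgeIdx n) : ℝ) - m with hM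
  set α := ((m : ℝ) + 1) * ((n : ℝ) - 2) / M with hα
  have hT4 : Ex n m (TT b 4) ≤ D * n := moment_TT hr (by linarith : 1 ≤ B) hC' 4
  have hT2 : Ex n m (TT b 2) ≤ D * n := (Ex_mono fun H _ => TT_mono hy.hb (by norm_num) H).trans hT4
  have hT1 : Ex n m (TT b 1) ≤ D * n := (Ex_mono fun H _ => TT_mono hy.hb (by norm_num) H).trans hT4
  set KX := Ex n m (fun H => KK s g H * (XX (sh h) (fd g) H : ℂ)) with hKX
  -- first estimate
  have A1 : ‖Ex n (m + 1) (fun G => vs g G • KK s g G) - α * (I * s * KX)‖ ≤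
      4 * D * (2 * Λ ^ 2 + 4 * Λ * |s| + 30 * Λ * (s ^ 2 * n)) := by
    rw [key hr.m_lt μ heq, ← hM]
    have e1 : (α : ℂ) * (I * s * KX) = M⁻¹ • Ex n m (fun H =>
        ((((m : ℝ) + 1) * ((n : ℝ) - 2) : ℝ) : ℂ) * (I * s * (KK s g H * (XX (sh h) (fd g) H : ℂ)))) := by
      rw [Ex_cmul, Ex_cmul, ← hKX, Complex.real_smul, hα]
      push_cast
      ring
    rw [e1, ← smul_sub, ← Ex_sub, norm_smul, Real.norm_of_nonneg (inv_nonneg.2 hMp.le)]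
    have e2 := norm_Ex_le_of (n := n) (m := m) fun H hH => t1_pt (s := s) hy hH
    have e3 : Ex n m (fun H => 2 * Λ ^ 2 * n * TT b 2 H + |s| * (4 * Λ * n * TT b 4 H)
        + 3 * s ^ 2 * (10 * Λ * n ^ 2 * TT b 4 H)) ≤
        2 * Λ ^ 2 * n * (D * n) + |s| * (4 * Λ * n * (D * n)) + 3 * s ^ 2 * (10 * Λ * n ^ 2 * (D * n)) := by
      rw [Ex_add, Ex_add, Ex_mul, Ex_mul, Ex_mul, Ex_mul, Ex_mul]
      gcongr
    calc _ ≤ (4 / (n : ℝ) ^ 2) * (2 * Λ ^ 2 * n * (D * n) + |s| * (4 * Λ * n * (D * n))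
            + 3 * s ^ 2 * (10 * Λ * n ^ 2 * (D * n))) := by
          gcongr
          exact e2.trans e3
      _ = _ := by field_simp; ring
  have A2 : ‖((α - μ : ℝ) : ℂ) * (I * s * KX)‖ ≤ 4 * Λ ^ 2 * D * |s| := by
    have e1 : ‖KX‖ ≤ 2 * (D * n) := by
      refine (norm_Ex_le_of (F' := fun H => 2 * TT b 2 H) fun H _ => ?_).trans ?_
      · rw [norm_mul, KK_norm, one_mul, Complex.norm_real, Real.norm_eq_abs]
        exact XX_bd hy.hb hr.n1 hsh hfg H
      · rw [Ex_mul]; gcongr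
    rw [norm_mul, norm_mul, norm_mul, Complex.norm_I, one_mul, Complex.norm_real, Complex.norm_real,
      Real.norm_eq_abs, Real.norm_eq_abs]
    calc _ ≤ (2 * Λ ^ 2 / n) * (|s| * (2 * (D * n))) := by gcongr
      _ = _ := by field_simp; ring
  have A3 : ‖(μ : ℂ) * (I * s * (KX - ((n * V0 : ℝ) : ℂ) * Ex n m (KK s g)))‖ ≤ Λ * (|s| * (Q * √n)) := by
    have e1 : ‖KX - ((n * V0 : ℝ) : ℂ) * Ex n m (KK s g)‖ ≤ Q * √n := by
      rw [hKX, ← Ex_cmul, ← Ex_sub]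
      refine (norm_Ex_le_of fun H _ => ?_).trans hX
      rw [mul_comm, ← sub_mul, norm_mul, KK_norm, mul_one, ← Complex.ofReal_sub, Complex.norm_real,
        Real.norm_eq_abs]
    rw [norm_mul, norm_mul, norm_mul, Complex.norm_I, one_mul, Complex.norm_real, Complex.norm_real,
      Real.norm_eq_abs, Real.norm_eq_abs, abs_of_pos hμ0]
    gcongr
  have A4 : ‖(μ : ℂ) * (I * s * ((n * V0 : ℝ) : ℂ)) * (Ex n m (KK s g) - Ex n (m + 1) (KK s g))‖ ≤
      Λ * (|s| * (n * Q)) * (4 * |s| * D) := by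
    have e1 : ‖Ex n m (KK s g) - Ex n (m + 1) (KK s g)‖ ≤ 4 * |s| * D := by
      refine (t4 hr hy).trans ?_
      calc _ ≤ 4 * |s| / n * (D * n) := by gcongr
        _ = _ := by field_simp
    rw [norm_mul, norm_mul, norm_mul, norm_mul, Complex.norm_I, one_mul, Complex.norm_real,
      Complex.norm_real, Complex.norm_real,
      Real.norm_eq_abs, Real.norm_eq_abs, Real.norm_eq_abs, abs_of_pos hμ0, abs_mul, Nat.abs_cast]
    gcongr
  have hdec : Ex n (m + 1) (fun G => vs g G • KK s g G) - I * s * n * VV μ f * Ex n (m + 1) (KK s g) =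
      (Ex n (m + 1) (fun G => vs g G • KK s g G) - α * (I * s * KX)) + ((α - μ : ℝ) : ℂ) * (I * s * KX)
      + (μ : ℂ) * (I * s * (KX - ((n * V0 : ℝ) : ℂ) * Ex n m (KK s g)))
      + (μ : ℂ) * (I * s * ((n * V0 : ℝ) : ℂ)) * (Ex n m (KK s g) - Ex n (m + 1) (KK s g)) := by
    rw [hVV]; push_cast; ring
  rw [hdec, abs_of_pos (by linarith : 0 < Λ)]
  have hw1 : 1 ≤ √(n : ℝ) := by rw [Real.one_le_sqrt]; exact hn
  have hs0 := abs_nonneg s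
  have hsw : |s| ≤ |s| * √n := le_mul_of_one_le_right hs0 hw1
  have hss : |s| * |s| = s ^ 2 := by rw [← sq, sq_abs]
  have hs2n : 0 ≤ s ^ 2 * n := by positivity
  have hsw0 : 0 ≤ |s| * √n := by positivity
  calc _ ≤ 4 * D * (2 * Λ ^ 2 + 4 * Λ * |s| + 30 * Λ * (s ^ 2 * n)) + 4 * Λ ^ 2 * D * |s|
        + Λ * (|s| * (Q * √n)) + Λ * (|s| * (n * Q)) * (4 * |s| * D) := by
        refine (norm_add_le _ _).trans (add_le_add ((norm_add_le _ _).trans (add_le_add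
          ((norm_add_le _ _).trans (add_le_add A1 A2)) A3)) A4)
    _ = 8 * Λ ^ 2 * D + (16 * Λ * D + 4 * Λ ^ 2 * D) * |s| + (Λ * Q) * (|s| * √n)
        + (120 * Λ * D + 4 * Λ * Q * D) * (s ^ 2 * n) := by rw [← hss]; ring
    _ ≤ 8 * Λ ^ 2 * D + (16 * Λ * D + 4 * Λ ^ 2 * D) * (|s| * √n) + (Λ * Q) * (|s| * √n)
        + (120 * Λ * D + 4 * Λ * Q * D) * (s ^ 2 * n) := by gcongr
    _ ≤ _ := by
        have p1 : 0 ≤ 8 * Λ ^ 2 * D := by positivity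
        have p2 : 0 ≤ 16 * Λ * D + 4 * Λ ^ 2 * D + Λ * Q := by positivity
        have p3 : 0 ≤ 120 * Λ * D + 4 * Λ * Q * D := by positivity
        nlinarith [mul_nonneg p1 hsw0, mul_nonneg p1 hs2n, mul_nonneg p2 hs2n, mul_nonneg p3 hsw0]

end GnmCLT

namespace GnmCLT
open Finset Complex

lemma ode {φ φ' : ℝ → ℂ} {V ε : ℝ} (hε : 0 ≤ ε) (hd : ∀ t, HasDerivAt φ (φ' t) t) (h0 : φ 0 = 1)
    (hb : ∀ t, ‖φ' t + t * V * φ t‖ ≤ ε * (1 + |t| + t ^ 2)) (t : ℝ) :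
    ‖φ t - cexp (-(V * t ^ 2 / 2))‖ ≤ ε * (1 + |t| + t ^ 2) * |t| * Real.exp (|V| * t ^ 2) := by
  set E : ℝ → ℂ := fun x => cexp (V * x ^ 2 / 2) with hE
  have hEd : ∀ x, HasDerivAt E (E x * (x * V)) x := by
    intro x
    have h1 : HasDerivAt (fun x : ℝ => ((V : ℂ) * (x : ℂ) ^ 2 / 2)) ((x : ℂ) * V) x := by
      have h2 : HasDerivAt (fun x : ℝ => (x : ℂ)) 1 x := by
        simpa using (hasDerivAt_id x).ofReal_comp
      have h3 := ((h2.pow 2).const_mul (V : ℂ)).div_const 2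
      refine h3.congr_deriv ?_
      push_cast
      ring
    exact h1.cexp
  have hEn : ∀ x, |x| ≤ |t| → ‖E x‖ ≤ Real.exp (|V| * t ^ 2 / 2) := by
    intro x hx
    have e : (V * (x : ℂ) ^ 2 / 2) = ((V * x ^ 2 / 2 : ℝ) : ℂ) := by push_cast; ring
    simp only [hE]
    rw [e, Complex.norm_exp_ofReal]
    apply Real.exp_le_exp.2
    have h2 : x ^ 2 ≤ t ^ 2 := sq_le_sq.2 hx
    have h3 : V * x ^ 2 ≤ |V| * t ^ 2 := mul_le_mul (le_abs_self _) h2 (sq_nonneg _) (abs_nonneg _)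
    linarith
  have hxt : ∀ x ∈ Set.uIcc 0 t, |x| ≤ |t| := by
    intro x hx
    rcases le_total 0 t with h | h
    · rw [Set.uIcc_of_le h] at hx
      rw [abs_of_nonneg hx.1, abs_of_nonneg h]; exact hx.2
    · rw [Set.uIcc_of_ge h] at hx
      rw [abs_of_nonpos hx.2, abs_of_nonpos h]; linarith [hx.1]
  have hmv := Convex.norm_image_sub_le_of_norm_hasDerivWithin_le (s := Set.uIcc 0 t)
    (f := fun x => φ x * E x) (f' := fun x => φ' x * E x + φ x * (E x * (x * V)))
    (C := ε * (1 + |t| + t ^ 2) * Real.exp (|V| * t ^ 2 / 2))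
    (fun x _ => ((hd x).mul (hEd x)).hasDerivWithinAt)
    (fun x hx => by
      have e : φ' x * E x + φ x * (E x * (x * V)) = (φ' x + x * V * φ x) * E x := by ring
      rw [e, norm_mul]
      have h1 := hxt x hx
      have h2 : x ^ 2 ≤ t ^ 2 := sq_le_sq.2 h1
      have h3 := hEn x h1
      refine mul_le_mul ((hb x).trans ?_) h3 (norm_nonneg _) (by positivity)
      gcongr)
    (convex_uIcc 0 t) Set.left_mem_uIcc Set.right_mem_uIcc
  have hE0 : E 0 = 1 := by simp [hE]
  simp only [h0, hE0, mul_one, sub_zero, Real.norm_eq_abs] at hmv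
  have hinv : E t * cexp (-(V * t ^ 2 / 2)) = 1 := by
    simp only [hE]; rw [← Complex.exp_add]; simp
  have e : φ t - cexp (-(V * t ^ 2 / 2)) = (φ t * E t - 1) * cexp (-(V * t ^ 2 / 2)) := by
    rw [sub_mul, mul_assoc, hinv]; ring
  have hn2 : ‖cexp (-(V * t ^ 2 / 2))‖ ≤ Real.exp (|V| * t ^ 2 / 2) := by
    have e : -(V * (t : ℂ) ^ 2 / 2) = ((-(V * t ^ 2 / 2) : ℝ) : ℂ) := by push_cast; ring
    rw [e, Complex.norm_exp_ofReal]
    apply Real.exp_le_exp.2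
    nlinarith [neg_abs_le V, sq_nonneg t]
  rw [e, norm_mul]
  calc _ ≤ (ε * (1 + |t| + t ^ 2) * Real.exp (|V| * t ^ 2 / 2) * |t|) * Real.exp (|V| * t ^ 2 / 2) := by
        gcongr
    _ = ε * (1 + |t| + t ^ 2) * |t| * (Real.exp (|V| * t ^ 2 / 2) * Real.exp (|V| * t ^ 2 / 2)) := by ring
    _ = _ := by rw [← Real.exp_add]; congr 2; ring

lemma KK_deriv {n : ℕ} (k : ℕ) (g : ℕ → ℝ) (w t : ℝ) :
    HasDerivAt (fun t : ℝ => Ex n k (KK (t / w) g))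
      (I / w * Ex n k (fun G => vs g G • KK (t / w) g G)) t := by
  rw [← Ex_cmul]
  unfold Ex
  refine HasDerivAt.const_smul _ (HasDerivAt.fun_sum fun G _ => ?_)
  unfold KK
  have h2 : HasDerivAt (fun x : ℝ => (x : ℂ)) 1 t := by
    simpa using (hasDerivAt_id t).ofReal_comp
  have h3 := (h2.const_mul (I * (vs g G / w : ℂ))).cexp
  refine (h3.congr_deriv ?_).congr_of_eventuallyEq (Eventually.of_forall fun x => ?_)
  · rw [Complex.real_smul]
    have : I * (vs g G / w : ℂ) * t = I * ((t / w * vs g G : ℝ) : ℂ) := by push_cast; ring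
    rw [this]
    ring
  · show cexp _ = cexp _
    congr 1
    push_cast
    ring

lemma norm_Ex_KK_le {n k : ℕ} (hk : k ≤ Fintype.card (EdgeIdx n)) (s : ℝ) (g : ℕ → ℝ) :
    ‖Ex n k (KK s g)‖ ≤ 1 := by
  have := norm_Ex_le_of (n := n) (m := k) (F := KK s g) (F' := fun _ => (1 : ℝ))
    (fun G _ => (KK_norm G).le)
  rwa [Ex_const hk] at this

lemma cf_quant (Λ C B : ℝ) (hC : 1 ≤ C) (hB : 2 ≤ B) :
    ∃ K' : ℝ, 0 ≤ K' ∧ ∀ n m : ℕ, Reg Λ n m → ∀ f : ℕ → ℝ, (∀ k, |f k| ≤ C * B ^ k) → ∀ t : ℝ,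
      ‖Ex n (m + 1) (KK (t / √n) (fun k => f k - pm (mu n m) f)) - cexp (-(VV (mu n m) f * t ^ 2 / 2))‖
      ≤ K' / √n * (1 + |t| + t ^ 2) * |t| * Real.exp (|VV (mu n m) f| * t ^ 2) := by
  obtain ⟨K', hK', hcf⟩ := cf_estimate Λ C B hC hB
  refine ⟨K', hK', ?_⟩
  intro n m hr f hf t
  have hn : (1 : ℝ) ≤ n := by exact_mod_cast hr.n1
  have hwp : 0 < √(n : ℝ) := Real.sqrt_pos.2 (by linarith)
  have hw2 : √(n : ℝ) ^ 2 = n := Real.sq_sqrt (by linarith)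
  refine ode (by positivity) (fun t => KK_deriv (m + 1) _ _ t) ?_ ?_ t
  · have : Ex n (m + 1) (KK (0 / √(n : ℝ)) (fun k => f k - pm (mu n m) f)) = Ex n (m + 1) (fun _ => (1 : ℂ)) := by
      refine Ex_congr fun G _ => ?_
      simp [KK]
    rw [this, Ex_const hr.m_lt]
  · intro t
    have h1 := hcf n m hr f hf (t / √n)
    set E1 := Ex n (m + 1) (fun G => vs (fun k => f k - pm (mu n m) f) G •
      KK (t / √n) (fun k => f k - pm (mu n m) f) G) with hE1
    set E0 := Ex n (m + 1) (KK (t / √n) (fun k => f k - pm (mu n m) f)) with hE0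
    have hwc : (√(n : ℝ) : ℂ) ≠ 0 := by exact_mod_cast hwp.ne'
    have hwc2 : (n : ℂ) = (√(n : ℝ) : ℂ) ^ 2 := by rw [← Complex.ofReal_pow, hw2]; simp
    have e : I / (√(n : ℝ) : ℂ) * E1 + t * VV (mu n m) f * E0 =
        I / (√(n : ℝ) : ℂ) * (E1 - I * ((t / √n : ℝ) : ℂ) * n * VV (mu n m) f * E0) := by
      rw [hwc2]
      push_cast
      field_simp
      ring_nf
      rw [Complex.I_sq]
      ring
    rw [e, norm_mul, norm_div, Complex.norm_I, Complex.norm_real, Real.norm_of_nonneg hwp.le]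
    have h2 : 1 + |t / √n| * √n + (t / √n) ^ 2 * n = 1 + |t| + t ^ 2 := by
      rw [abs_div, abs_of_pos hwp, div_pow, hw2]
      field_simp
    rw [h2] at h1
    calc _ ≤ 1 / √n * (K' * (1 + |t| + t ^ 2)) := by gcongr
      _ = _ := by ring

lemma cf_tendsto (m : ℕ → ℕ) {lam : ℝ} (hlam : 0 < lam)
    (hconv : Tendsto (fun n => 2 * (m n : ℝ) / n) atTop (𝓝 lam))
    {a : ℕ → ℝ} (ha : EB a) :
    (∀ᶠ n in atTop, m n ≤ Fintype.card (EdgeIdx n)) ∧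
    ∀ t : ℝ, Tendsto (fun n => Ex n (m n) (KK (t / √n) (fun k => a k - pm (2 * (m n : ℝ) / n) a))) atTop
      (𝓝 (cexp (-(VV lam a * t ^ 2 / 2)))) := by
  obtain ⟨C, B, hC, hB, hf⟩ := EB_iff.1 ha
  set Λ := 1 + lam with hΛ
  have hreg : ∀ᶠ n in atTop, ∃ j, m n = j + 1 ∧ Reg Λ n j ∧ mu n j = 2 * (m n : ℝ) / n := by
    have h1 := hconv.eventually_lt_const (by linarith : lam < Λ)
    have h2 := hconv.eventually_const_lt hlam
    have h3 := tendsto_natCast_atTop_atTop (R := ℝ) |>.eventually_ge_atTop (2 * (1 + Λ))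
    filter_upwards [h1, h2, h3] with n h1 h2 h3
    have hn : (0 : ℝ) < n := by linarith
    have hm : m n ≠ 0 := by
      intro h
      simp [h] at h2
    obtain ⟨j, hj⟩ := Nat.exists_eq_succ_of_ne_zero hm
    refine ⟨j, hj, ⟨by linarith, h3, ?_⟩, ?_⟩
    · rw [div_lt_iff₀ hn, hj] at h1
      push_cast at h1
      linarith
    · rw [mu, hj]; push_cast; rfl
  refine ⟨?_, fun t => ?_⟩
  · filter_upwards [hreg] with n ⟨j, hj, hr, _⟩
    rw [hj]; exact hr.m_lt
  · obtain ⟨K', hK', hq⟩ := cf_quant Λ C B hC hB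
    have hV : Tendsto (fun n => VV (2 * (m n : ℝ) / n) a) atTop (𝓝 (VV lam a)) :=
      (VV_continuous ha hlam).tendsto.comp hconv
    have hE : Tendsto (fun n => cexp (-(VV (2 * (m n : ℝ) / n) a * t ^ 2 / 2))) atTop
        (𝓝 (cexp (-(VV lam a * t ^ 2 / 2)))) := by
      have : Continuous fun x : ℝ => cexp (-((x : ℂ) * t ^ 2 / 2)) := by fun_prop
      exact (this.tendsto _).comp hV
    have hsq : Tendsto (fun n : ℕ => √(n : ℝ)) atTop atTop :=
      Real.tendsto_sqrt_atTop.comp tendsto_natCast_atTop_atTop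
    have hB0 : Tendsto (fun n : ℕ => K' / √n * (1 + |t| + t ^ 2) * |t| *
        Real.exp (|VV (2 * (m n : ℝ) / n) a| * t ^ 2)) atTop (𝓝 0) := by
      have h1 : Tendsto (fun n : ℕ => K' / √(n : ℝ)) atTop (𝓝 0) := hsq.const_div_atTop K'
      have h2 : Tendsto (fun n : ℕ => Real.exp (|VV (2 * (m n : ℝ) / n) a| * t ^ 2)) atTop
          (𝓝 (Real.exp (|VV lam a| * t ^ 2))) :=
        (Real.continuous_exp.tendsto _).comp (hV.abs.mul_const _)
      simpa using ((h1.mul_const (1 + |t| + t ^ 2)).mul_const |t|).mul h2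
    have hdiff : Tendsto (fun n => Ex n (m n) (KK (t / √n) (fun k => a k - pm (2 * (m n : ℝ) / n) a))
        - cexp (-(VV (2 * (m n : ℝ) / n) a * t ^ 2 / 2))) atTop (𝓝 0) := by
      refine squeeze_zero_norm' ?_ hB0
      filter_upwards [hreg] with n ⟨j, hj, hr, hmu⟩
      have := hq n j hr a hf t
      rw [hmu, ← hj] at this
      exact this
    simpa using hdiff.add hE

lemma VV_nonneg (m : ℕ → ℕ) {lam : ℝ} (hlam : 0 < lam)
    (hconv : Tendsto (fun n => 2 * (m n : ℝ) / n) atTop (𝓝 lam))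
    {a : ℕ → ℝ} (ha : EB a) : 0 ≤ VV lam a := by
  obtain ⟨h1, h2⟩ := cf_tendsto m hlam hconv ha
  have h3 := le_of_tendsto (h2 1).norm (h1.mono fun n hn => norm_Ex_KK_le hn _ _)
  have e : -((VV lam a : ℂ) * (1 : ℝ) ^ 2 / 2) = ((-(VV lam a / 2) : ℝ) : ℂ) := by push_cast; ring
  rw [e, Complex.norm_exp_ofReal, Real.exp_le_one_iff] at h3
  linarith

/-- the edge set of a graph given by its indicator -/
def edg {n : ℕ} (S : EdgeIdx n → Bool) : Finset (EdgeIdx n) := univ.filter fun e => S e = true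

lemma edg_dg {n : ℕ} (S : EdgeIdx n → Bool) (v : Fin n) : degree n S v = dg (edg S) v := by
  unfold degree dg edg
  rw [filter_filter]

lemma sum_edg {E : Type*} [AddCommMonoid E] (n m : ℕ) (F : Finset (EdgeIdx n) → E) :
    ∑ S ∈ (univ.filter fun S : EdgeIdx n → Bool => edgeCount n S = m), F (edg S) =
      ∑ G ∈ powersetCard m (univ : Finset (EdgeIdx n)), F G := by
  refine sum_nbij' (fun S => edg S) (fun G e => decide (e ∈ G)) ?_ ?_ ?_ ?_ ?_
  · intro S hS
    simp only [mem_filter, mem_univ, true_and] at hS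
    rw [mem_powersetCard]
    exact ⟨subset_univ _, hS⟩
  · intro G hG
    rw [mem_powersetCard] at hG
    rw [mem_filter]
    refine ⟨mem_univ _, ?_⟩
    simp [edgeCount, hG.2]
  · intro S _
    ext e
    simp [edg]
  · intro G _
    ext e
    simp [edg]
  · intro S _; rfl

lemma card_edg (n m : ℕ) : (univ.filter fun S : EdgeIdx n → Bool => edgeCount n S = m).card =
    (Fintype.card (EdgeIdx n)).choose m := by
  have := sum_edg n m (fun _ => (1 : ℕ))
  simpa using this

lemma gnm_prob {n m : ℕ} (hm : m ≤ Fintype.card (EdgeIdx n)) : IsProbabilityMeasure (gnmMeasure n m) := by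
  constructor
  unfold gnmMeasure
  simp only [Measure.coe_finsetSum, Finset.sum_apply, Measure.smul_apply, measure_univ, smul_eq_mul, mul_one]
  rw [← sum_filter, sum_const, nsmul_eq_mul]
  have h := Nat.choose_pos hm
  rw [← card_edg] at h
  exact ENNReal.mul_inv_cancel (by exact_mod_cast h.ne') (ENNReal.natCast_ne_top _)

lemma gnm_integral {n m : ℕ} (F : Finset (EdgeIdx n) → ℂ) :
    ∫ S, F (edg S) ∂(gnmMeasure n m) = Ex n m F := by
  unfold gnmMeasure
  have hintg : ∀ S : EdgeIdx n → Bool, Integrable (fun S => F (edg S)) ((if edgeCount n S = m then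
        ((univ.filter fun S' : EdgeIdx n → Bool => edgeCount n S' = m).card : ℝ≥0∞)⁻¹
      else 0) • Measure.dirac S) := by
    intro S
    refine Integrable.smul_measure (Integrable.of_finite) ?_
    split_ifs with h
    · rw [ENNReal.inv_ne_top]
      have : S ∈ (univ.filter fun S' : EdgeIdx n → Bool => edgeCount n S' = m) := by simp [h]
      exact_mod_cast (card_pos.2 ⟨S, this⟩).ne'
    · exact ENNReal.zero_ne_top
  rw [integral_finsetSum_measure fun S _ => hintg S]
  have h2 : ∀ S : EdgeIdx n → Bool, ∫ S, F (edg S) ∂((if edgeCount n S = m then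
        ((univ.filter fun S' : EdgeIdx n → Bool => edgeCount n S' = m).card : ℝ≥0∞)⁻¹
      else 0) • Measure.dirac S) = if edgeCount n S = m then
        (((Fintype.card (EdgeIdx n)).choose m : ℝ)⁻¹ • F (edg S)) else 0 := by
    intro S
    rw [integral_smul_measure, integral_dirac, card_edg]
    split_ifs <;> simp
  simp_rw [h2]
  rw [← sum_filter, ← smul_sum, sum_edg n m F]
  rfl

lemma tsum_degCount {n : ℕ} (a : ℕ → ℝ) (S : EdgeIdx n → Bool) :
    ∑' k : ℕ, a k * (degCount n k S : ℝ) = vs a (edg S) := by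
  have h1 : ∀ k, a k * (degCount n k S : ℝ) = ∑ v : Fin n, if k = dg (edg S) v then a k else 0 := by
    intro k
    unfold degCount
    rw [← sum_filter, sum_const, nsmul_eq_mul, mul_comm]
    simp_rw [edg_dg, eq_comm (a := k)]
  simp_rw [h1]
  rw [Summable.tsum_finsetSum fun v _ => ?_]
  · unfold vs
    refine sum_congr rfl fun v _ => ?_
    rw [tsum_ite_eq]
  · exact (hasSum_ite_eq (dg (edg S) v) (a (dg (edg S) v))).summable.congr fun k => by
      split_ifs with h
      · rw [h]
      · rfl

end GnmCLT

open GnmCLT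
/-- Theorem 4.1(ii), linear-combination form: asymptotic normality of `Σ_k a_k N_k` in
`G(n, m)` with `λₙ := 2m/n → λ > 0`, for coefficients `a_k = O(A^k)`. -/
theorem gnm_degree_counts_linear_combination_clt
    (m : ℕ → ℕ) (lam : ℝ) (hlam : 0 < lam)
    (hconv : Tendsto (fun n => 2 * (m n : ℝ) / n) atTop (𝓝 lam))
    (a : ℕ → ℝ) (A : ℝ) (hA : ∃ C : ℝ, ∀ k, |a k| ≤ C * A ^ k) :
    TendstoInDistribution
      (fun n => (gnmMeasure n (m n)).map
        (fun S => (Real.sqrt n)⁻¹ *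
          ((∑' k : ℕ, a k * (degCount n k S : ℝ)) -
            n * ∑' k : ℕ, a k * poissonProb (2 * (m n : ℝ) / n) k)))
      (gaussianReal 0
        (Real.toNNReal
          (∑' j : ℕ, ∑' k : ℕ, a j * a k *
            (poissonProb lam j * poissonProb lam k *
                (-(((j : ℝ) - lam) * ((k : ℝ) - lam) / lam) - 1) +
              poissonProb lam k * (if j = k then 1 else 0))))) := by

  have ha : EB a := by
    obtain ⟨C, h⟩ := hA
    exact ⟨C, A, h⟩
  rw [VV_eq_tsum hlam ha]
  have hV := VV_nonneg m hlam hconv ha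
  obtain ⟨hcard, hcf⟩ := cf_tendsto m hlam hconv ha
  set Y : (n : ℕ) → (EdgeIdx n → Bool) → ℝ := fun n S => (Real.sqrt n)⁻¹ *
          ((∑' k : ℕ, a k * (degCount n k S : ℝ)) -
            n * ∑' k : ℕ, a k * poissonProb (2 * (m n : ℝ) / n) k) with hY
  have hYm : ∀ n, Measurable (Y n) := fun n => Measurable.of_discrete
  have hchar : ∀ n, ∀ t : ℝ, charFun ((gnmMeasure n (m n)).map (Y n)) t =
      Ex n (m n) (KK (t / √n) (fun k => a k - pm (2 * (m n : ℝ) / n) a)) := by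
    intro n t
    rw [charFun_apply_real, integral_map (hYm n).aemeasurable (by fun_prop), ← gnm_integral]
    congr 1
    ext S
    unfold KK
    congr 1
    have : t * Y n S = t / √n * vs (fun k => a k - pm (2 * (m n : ℝ) / n) a) (edg S) := by
      simp only [hY]
      rw [tsum_degCount]
      have h2 : vs (fun k => a k - pm (2 * (m n : ℝ) / n) a) (edg S) =
          vs a (edg S) - n * pm (2 * (m n : ℝ) / n) a := by
        simp [vs]
      rw [h2, div_eq_mul_inv]
      unfold pm
      ring
    rw [← this]
    push_cast
    ring
  have hprob : ∀ᶠ n in atTop, IsProbabilityMeasure ((gnmMeasure n (m n)).map (Y n)) := by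
    filter_upwards [hcard] with n hn
    have := gnm_prob hn
    exact Measure.isProbabilityMeasure_map (hYm n).aemeasurable
  classical
  let P : ℕ → ProbabilityMeasure ℝ := fun n =>
    if h : IsProbabilityMeasure ((gnmMeasure n (m n)).map (Y n)) then ⟨_, h⟩
    else ⟨Measure.dirac 0, inferInstance⟩
  have hP : ∀ᶠ n in atTop, (P n : Measure ℝ) = (gnmMeasure n (m n)).map (Y n) := by
    filter_upwards [hprob] with n hn
    have : P n = ⟨_, hn⟩ := dif_pos hn
    rw [this]
    rfl
  let P0 : ProbabilityMeasure ℝ := ⟨gaussianReal 0 (Real.toNNReal (VV lam a)), inferInstance⟩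
  have hlim : Tendsto P atTop (𝓝 P0) := by
    rw [ProbabilityMeasure.tendsto_iff_tendsto_charFun]
    intro t
    have e : charFun (P0 : Measure ℝ) t = Complex.exp (-(VV lam a * t ^ 2 / 2)) := by
      show charFun (gaussianReal 0 (Real.toNNReal (VV lam a))) t = _
      rw [charFun_gaussianReal]
      congr 1
      have : ((Real.toNNReal (VV lam a) : ℝ) : ℂ) = (VV lam a : ℂ) := by
        rw [Real.coe_toNNReal _ hV]
      rw [this]
      simp
    rw [e]
    refine (hcf t).congr' ?_
    filter_upwards [hP] with n hn
    rw [hn, hchar]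
  intro f
  have := (ProbabilityMeasure.tendsto_iff_forall_integral_tendsto.1 hlim) f
  refine Tendsto.congr' ?_ this
  filter_upwards [hP] with n hn
  rw [hn]
end
end

section
/- Let B > 0 and let λ_n be positive reals with λ_n ≤ B for all n. In the random graph G(n, λ_n/n), let N_k be the number of vertices of degree k. Then there is a constant C = C(B) < ∞ such that Var(N_k) ≤ C n B^k / k! for all n ≥ 1 and all k ≥ 0. -/
open MeasureTheory ProbabilityTheory Filter Topology

noncomputable section

open scoped ENNReal

open Polynomial in
theorem gg_sum_prod {R : Type*} [CommRing R] (φ : ℝ →+* R) (n : ℕ) (p : ℝ) (z : EdgeIdx n → R) :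
    ∑ S : EdgeIdx n → Bool, φ (∏ e, if S e then p else 1 - p) * ∏ e, (if S e then z e else 1)
      = ∏ e, (φ (1 - p) + φ p * z e) := by
  have h := Finset.prod_univ_sum (fun _ : EdgeIdx n => (Finset.univ : Finset Bool))
    (fun e b => if b then φ p * z e else φ (1 - p))
  rw [Fintype.piFinset_univ] at h
  have h3 : ∏ e, (φ (1 - p) + φ p * z e) =
      ∏ e : EdgeIdx n, ∑ b : Bool, if b then φ p * z e else φ (1 - p) := by
    refine Finset.prod_congr rfl fun e _ => ?_
    simp [add_comm]
  rw [h3, h]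
  · refine Finset.sum_congr rfl fun S _ => ?_
    rw [map_prod, ← Finset.prod_mul_distrib]
    refine Finset.prod_congr rfl fun e _ => ?_
    cases S e <;> simp

theorem gg_pow_degree {R : Type*} [CommRing R] (n : ℕ) (S : EdgeIdx n → Bool) (v : Fin n) (x : R) :
    x ^ degree n S v = ∏ e : EdgeIdx n, (if S e then (if v ∈ (e : Sym2 (Fin n)) then x else 1) else 1) := by
  classical
  unfold degree
  rw [← Finset.prod_const, Finset.prod_filter]
  refine Finset.prod_congr rfl fun e _ => ?_
  by_cases h : S e = true <;> by_cases h' : v ∈ (e : Sym2 (Fin n)) <;> simp [h, h']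

theorem gg_single {R : Type*} [CommRing R] (φ : ℝ →+* R) (n : ℕ) (p : ℝ) (v : Fin n) :
    ∃ m ≤ n, ∀ x : R, ∑ S : EdgeIdx n → Bool, φ (∏ e, if S e then p else 1 - p) * x ^ degree n S v
      = (φ (1 - p) + φ p * x) ^ m := by
  classical
  refine ⟨(Finset.univ.filter fun e : EdgeIdx n => v ∈ (e : Sym2 (Fin n))).card, ?_, fun x => ?_⟩
  · have := Finset.card_le_card_of_surjOn (s := (Finset.univ : Finset (Fin n)))
      (t := (Finset.univ.filter fun e : EdgeIdx n => v ∈ (e : Sym2 (Fin n))).image Subtype.val)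
      (fun u => s(v, u)) (by
        intro e he
        simp only [Finset.coe_image, Set.mem_image, Finset.mem_coe, Finset.mem_filter] at he
        obtain ⟨e', ⟨-, he'⟩, rfl⟩ := he
        obtain ⟨u, hu⟩ := he'
        exact ⟨u, by simp, hu.symm⟩)
    rw [Finset.card_image_of_injective _ Subtype.val_injective] at this
    simpa using this
  · simp_rw [gg_pow_degree]
    rw [gg_sum_prod, ← Finset.prod_const, Finset.prod_filter]
    refine Finset.prod_congr rfl fun e _ => ?_
    split_ifs
    · rfl
    · rw [mul_one, ← map_add]; simp

theorem gg_pair {R : Type*} [CommRing R] (φ : ℝ →+* R) (n : ℕ) (p : ℝ) (v w : Fin n) (hvw : v ≠ w)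
    (x y : R) :
    ∑ S : EdgeIdx n → Bool, φ (∏ e, if S e then p else 1 - p) *
        (x ^ degree n S v * y ^ degree n S w)
      = (φ (1 - p) + φ p * (x * y)) *
        (φ (1 - p) + φ p * x) ^ (Finset.univ.filter fun e : EdgeIdx n => v ∈ (e : Sym2 (Fin n)) ∧ w ∉ (e : Sym2 (Fin n))).card *
        (φ (1 - p) + φ p * y) ^ (Finset.univ.filter fun e : EdgeIdx n => w ∈ (e : Sym2 (Fin n)) ∧ v ∉ (e : Sym2 (Fin n))).card := by
  classical
  simp_rw [gg_pow_degree, ← Finset.prod_mul_distrib]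
  have h1 : ∀ S : EdgeIdx n → Bool, (∏ e : EdgeIdx n, ((if S e then (if v ∈ (e : Sym2 (Fin n)) then x else 1) else 1) *
      (if S e then (if w ∈ (e : Sym2 (Fin n)) then y else 1) else 1))) =
      ∏ e : EdgeIdx n, (if S e then ((if v ∈ (e : Sym2 (Fin n)) then x else 1) * (if w ∈ (e : Sym2 (Fin n)) then y else 1)) else 1) := by
    intro S
    refine Finset.prod_congr rfl fun e _ => ?_
    split_ifs <;> simp
  simp_rw [h1]
  rw [gg_sum_prod]
  have h0 : (φ (1 - p) + φ p * (x * y)) =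
      ∏ e ∈ (Finset.univ.filter fun e : EdgeIdx n => v ∈ (e : Sym2 (Fin n)) ∧ w ∈ (e : Sym2 (Fin n))),
        (φ (1 - p) + φ p * (x * y)) := by
    have : (Finset.univ.filter fun e : EdgeIdx n => v ∈ (e : Sym2 (Fin n)) ∧ w ∈ (e : Sym2 (Fin n)))
        = {⟨s(v, w), by simpa using hvw⟩} := by
      ext e
      simp only [Finset.mem_filter, Finset.mem_univ, true_and, Finset.mem_singleton,
        Sym2.mem_and_mem_iff hvw, Subtype.ext_iff]
    rw [this, Finset.prod_singleton]
  rw [h0, ← Finset.prod_const, ← Finset.prod_const, Finset.prod_filter, Finset.prod_filter,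
    Finset.prod_filter, ← Finset.prod_mul_distrib, ← Finset.prod_mul_distrib]
  have h2 : φ (1 - p) + φ p = 1 := by rw [← map_add]; simp
  refine Finset.prod_congr rfl fun e _ => ?_
  by_cases hv : v ∈ (e : Sym2 (Fin n)) <;> by_cases hw : w ∈ (e : Sym2 (Fin n)) <;> simp [hv, hw, h2]

theorem gg_card_le (n : ℕ) (v w : Fin n) :
    (Finset.univ.filter fun e : EdgeIdx n => v ∈ (e : Sym2 (Fin n)) ∧ w ∉ (e : Sym2 (Fin n))).card ≤ n := by
  classical
  have := Finset.card_le_card_of_surjOn (s := (Finset.univ : Finset (Fin n)))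
      (t := (Finset.univ.filter fun e : EdgeIdx n => v ∈ (e : Sym2 (Fin n)) ∧ w ∉ (e : Sym2 (Fin n))).image Subtype.val)
      (fun u => s(v, u)) (by
        intro e he
        simp only [Finset.coe_image, Set.mem_image, Finset.mem_coe, Finset.mem_filter] at he
        obtain ⟨e', ⟨-, he', -⟩, rfl⟩ := he
        obtain ⟨u, hu⟩ := he'
        exact ⟨u, by simp, hu.symm⟩)
  rw [Finset.card_image_of_injective _ Subtype.val_injective] at this
  simpa using this

/-- The coefficients of the binomial generating polynomial. -/
def ggq (p : ℝ) (m j : ℕ) : ℝ :=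
  ((Polynomial.C (1 - p) + Polynomial.C p * Polynomial.X) ^ m : Polynomial ℝ).coeff j

theorem ggq_eq (p : ℝ) (m j : ℕ) :
    ggq p m j = p ^ j * (1 - p) ^ (m - j) * (m.choose j : ℝ) := by
  unfold ggq
  have : (Polynomial.C (1 - p) + Polynomial.C p * Polynomial.X : Polynomial ℝ)
      = (Polynomial.X + Polynomial.C (1 - p)).comp (Polynomial.C p * Polynomial.X) := by
    simp [add_comm]
  rw [this, ← Polynomial.pow_comp, Polynomial.comp_C_mul_X_coeff, Polynomial.coeff_X_add_C_pow]
  ring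

theorem ggq_nonneg (p : ℝ) (h0 : 0 ≤ p) (h1 : p ≤ 1) (m j : ℕ) : 0 ≤ ggq p m j := by
  rw [ggq_eq]
  have : 0 ≤ 1 - p := by linarith
  positivity

theorem ggq_le (p B : ℝ) (h0 : 0 ≤ p) (h1 : p ≤ 1) (n m j : ℕ) (hm : m ≤ n) (hB : n * p ≤ B) :
    ggq p m j ≤ B ^ j / (j.factorial : ℝ) := by
  rw [ggq_eq]
  have h2 : 0 ≤ 1 - p := by linarith
  have h3 : (1 - p) ^ (m - j) ≤ 1 := pow_le_one₀ h2 (by linarith)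
  have h4 : (m.choose j : ℝ) ≤ (m : ℝ) ^ j / (j.factorial : ℝ) := Nat.choose_le_pow_div j m
  have h5 : (m : ℝ) * p ≤ B := le_trans (by gcongr) hB
  calc p ^ j * (1 - p) ^ (m - j) * (m.choose j : ℝ) ≤ p ^ j * 1 * ((m : ℝ) ^ j / (j.factorial : ℝ)) := by
        gcongr
    _ = ((m : ℝ) * p) ^ j / (j.factorial : ℝ) := by rw [mul_pow]; ring
    _ ≤ _ := by gcongr

/-- Weights. -/
def ggW (n : ℕ) (p : ℝ) (S : EdgeIdx n → Bool) : ℝ := ∏ e, if S e then p else 1 - p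

theorem gg_diag (n : ℕ) (p B : ℝ) (h0 : 0 ≤ p) (h1 : p ≤ 1) (hB : n * p ≤ B) (v : Fin n) (k : ℕ) :
    ∑ S : EdgeIdx n → Bool, ggW n p S * (if degree n S v = k then 1 else 0) ≤
      B ^ k / (k.factorial : ℝ) := by
  obtain ⟨m, hm, h⟩ := gg_single (Polynomial.C : ℝ →+* Polynomial ℝ) n p v
  have h := congrArg (fun P => Polynomial.coeff P k) (h Polynomial.X)
  simp only [Polynomial.finsetSum_coeff, Polynomial.coeff_C_mul, Polynomial.coeff_X_pow] at h
  have h' : ∑ S : EdgeIdx n → Bool, ggW n p S * (if degree n S v = k then 1 else 0) = ggq p m k := by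
    unfold ggq
    rw [← h]
    simp only [ggW, eq_comm]
  rw [h']
  exact ggq_le p B h0 h1 n m k hm hB

/-- Coefficients shifted by one. -/
def ggq' (p : ℝ) (m : ℕ) : ℕ → ℝ
  | 0 => 0
  | j + 1 => ggq p m j

theorem gg_single' (n : ℕ) (p : ℝ) (v w : Fin n) (hvw : v ≠ w) (k : ℕ) :
    ∑ S : EdgeIdx n → Bool, ggW n p S * (if degree n S v = k then 1 else 0) =
      (1 - p) * ggq p (Finset.univ.filter fun e : EdgeIdx n => v ∈ (e : Sym2 (Fin n)) ∧ w ∉ (e : Sym2 (Fin n))).card k +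
      p * ggq' p (Finset.univ.filter fun e : EdgeIdx n => v ∈ (e : Sym2 (Fin n)) ∧ w ∉ (e : Sym2 (Fin n))).card k := by
  have h := congrArg (fun P => Polynomial.coeff P k)
    (gg_pair (Polynomial.C : ℝ →+* Polynomial ℝ) n p v w hvw Polynomial.X 1)
  have h2 : (Polynomial.C (1 - p) + Polynomial.C p : Polynomial ℝ) = 1 := by rw [← map_add]; simp
  simp only [mul_one, one_pow, h2, Polynomial.finsetSum_coeff, Polynomial.coeff_C_mul,
    Polynomial.coeff_X_pow, add_mul, Polynomial.coeff_add, mul_assoc] at h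
  have h' : ∑ S : EdgeIdx n → Bool, ggW n p S * (if degree n S v = k then 1 else 0) =
    ∑ S : EdgeIdx n → Bool, (∏ e, if S e then p else 1 - p) * (if k = degree n S v then 1 else 0) := by
    simp only [ggW, eq_comm]
  rw [h', h]
  cases k with
  | zero => simp [ggq', ggq]
  | succ j => simp [ggq', ggq, Polynomial.coeff_X_mul]

theorem gg_pair' (n : ℕ) (p : ℝ) (v w : Fin n) (hvw : v ≠ w) (k : ℕ) :
    ∑ S : EdgeIdx n → Bool, ggW n p S * ((if degree n S v = k then 1 else 0) * (if degree n S w = k then 1 else 0)) =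
      (1 - p) * (ggq p (Finset.univ.filter fun e : EdgeIdx n => v ∈ (e : Sym2 (Fin n)) ∧ w ∉ (e : Sym2 (Fin n))).card k *
        ggq p (Finset.univ.filter fun e : EdgeIdx n => w ∈ (e : Sym2 (Fin n)) ∧ v ∉ (e : Sym2 (Fin n))).card k) +
      p * (ggq' p (Finset.univ.filter fun e : EdgeIdx n => v ∈ (e : Sym2 (Fin n)) ∧ w ∉ (e : Sym2 (Fin n))).card k *
        ggq' p (Finset.univ.filter fun e : EdgeIdx n => w ∈ (e : Sym2 (Fin n)) ∧ v ∉ (e : Sym2 (Fin n))).card k) := by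
  have h := congrArg (fun P => Polynomial.coeff (Polynomial.coeff P k) k)
    (gg_pair ((Polynomial.C : Polynomial ℝ →+* Polynomial (Polynomial ℝ)).comp (Polynomial.C : ℝ →+* Polynomial ℝ))
      n p v w hvw (Polynomial.C Polynomial.X) Polynomial.X)
  generalize (Finset.univ.filter fun e : EdgeIdx n => v ∈ (e : Sym2 (Fin n)) ∧ w ∉ (e : Sym2 (Fin n))).card = a at h ⊢
  generalize (Finset.univ.filter fun e : EdgeIdx n => w ∈ (e : Sym2 (Fin n)) ∧ v ∉ (e : Sym2 (Fin n))).card = b at h ⊢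
  set P : Polynomial ℝ := Polynomial.C (1 - p) + Polynomial.C p * Polynomial.X with hP
  have e1 : (Polynomial.C (Polynomial.C (1 - p)) + Polynomial.C (Polynomial.C p) * Polynomial.C Polynomial.X
      : Polynomial (Polynomial ℝ)) = Polynomial.C P := by simp [hP]
  have e2 : (Polynomial.C (Polynomial.C (1 - p)) + Polynomial.C (Polynomial.C p) * Polynomial.X
      : Polynomial (Polynomial ℝ)) = P.map Polynomial.C := by simp [hP]
  simp only [RingHom.comp_apply] at h
  rw [e1, e2, ← Polynomial.C_pow, ← Polynomial.map_pow] at h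
  have e3 : ((Polynomial.C (Polynomial.C (1 - p)) + Polynomial.C (Polynomial.C p) * (Polynomial.C Polynomial.X * Polynomial.X)) *
      Polynomial.C (P ^ a) * (P ^ b).map Polynomial.C : Polynomial (Polynomial ℝ)) =
      Polynomial.C (Polynomial.C (1 - p) * P ^ a) * (P ^ b).map Polynomial.C +
      Polynomial.C (Polynomial.C p * (Polynomial.X * P ^ a)) * (Polynomial.X * (P ^ b).map Polynomial.C) := by
    simp only [Polynomial.C_mul]; ring
  rw [e3] at h
  have h' : ∑ S : EdgeIdx n → Bool, ggW n p S * ((if degree n S v = k then 1 else 0) * (if degree n S w = k then 1 else 0)) =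
      Polynomial.coeff (Polynomial.coeff (∑ S : EdgeIdx n → Bool, Polynomial.C (Polynomial.C (∏ e, if S e then p else 1 - p)) *
        (Polynomial.C Polynomial.X ^ degree n S v * Polynomial.X ^ degree n S w) : Polynomial (Polynomial ℝ)) k) k := by
    simp only [Polynomial.finsetSum_coeff, ← Polynomial.C_pow, Polynomial.coeff_C_mul, Polynomial.coeff_X_pow]
    refine Finset.sum_congr rfl fun S _ => ?_
    by_cases h1 : degree n S v = k <;> by_cases h2 : degree n S w = k <;>
      simp [h1, h2, ggW, Polynomial.coeff_X_pow, eq_comm (a := k)]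
  rw [h', h]
  cases k with
  | zero =>
    simp only [ggq', ggq, Polynomial.coeff_add, Polynomial.coeff_C_mul, Polynomial.coeff_map, mul_assoc, ← hP,
      Polynomial.coeff_mul_C, Polynomial.coeff_X_mul_zero, mul_zero, Polynomial.coeff_zero]
  | succ j => 
    simp only [ggq', ggq, Polynomial.coeff_add, Polynomial.coeff_C_mul, Polynomial.coeff_X_mul, Polynomial.coeff_map, mul_assoc, ← hP,
      Polynomial.coeff_mul_C]

theorem gg_integral (n : ℕ) (p : ℝ) (f : (EdgeIdx n → Bool) → ℝ) :
    ∫ S, f S ∂(gnpMeasure n p) = ∑ S, (∏ e, if S e then (ENNReal.ofReal p).toReal else (ENNReal.ofReal (1 - p)).toReal) * f S := by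
  unfold gnpMeasure
  rw [integral_finsetSum_measure]
  · refine Finset.sum_congr rfl fun S _ => ?_
    rw [integral_smul_measure, integral_dirac, ENNReal.toReal_prod, smul_eq_mul]
    congr 1
    refine Finset.prod_congr rfl fun e _ => ?_
    split_ifs <;> rfl
  · intro S _
    refine Integrable.smul_measure (integrable_dirac (by simp)) ?_
    refine (ENNReal.prod_lt_top fun e _ => ?_).ne
    split_ifs <;> simp

theorem gg_cov_large (n : ℕ) (p : ℝ) (hp : 1 < p) (f : (EdgeIdx n → Bool) → ℝ) :
    covFn (gnpMeasure n p) f f ≤ 0 := by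
  unfold covFn
  rw [gg_integral, gg_integral]
  rw [ENNReal.toReal_ofReal (by linarith), ENNReal.ofReal_of_nonpos (by linarith : 1 - p ≤ 0)]
  have key : ∀ g : (EdgeIdx n → Bool) → ℝ, ∑ S : EdgeIdx n → Bool, (∏ e, if S e then p else (0 : ENNReal).toReal) * g S
      = p ^ (Fintype.card (EdgeIdx n)) * g (fun _ => true) := by
    intro g
    rw [Finset.sum_eq_single (fun _ => true)]
    · simp
    · intro S _ hS
      obtain ⟨e, he⟩ := Function.ne_iff.mp hS
      rw [Finset.prod_eq_zero (Finset.mem_univ e), zero_mul]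
      simp at he
      simp [he]
    · simp
  rw [key, key]
  have : 1 ≤ p ^ (Fintype.card (EdgeIdx n)) := one_le_pow₀ hp.le
  generalize p ^ (Fintype.card (EdgeIdx n)) = M at *
  generalize f (fun _ => true) = t
  nlinarith [mul_nonneg (mul_nonneg (sub_nonneg.mpr this) (by linarith : 0 ≤ M)) (sq_nonneg t)]

theorem ggq'_sq (p B : ℝ) (hB0 : 0 < B) (h0 : 0 ≤ p) (h1 : p ≤ 1) (n m k : ℕ) (hm : m ≤ n) (hB : n * p ≤ B) :
    ggq' p m k ^ 2 ≤ Real.exp (2 * B) / B * (B ^ k / (k.factorial : ℝ)) := by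
  cases k with
  | zero =>
    simp only [ggq']
    rw [zero_pow two_ne_zero]
    positivity
  | succ j =>
    simp only [ggq']
    have a := ggq_le p B h0 h1 n m j hm hB
    have b := ggq_nonneg p h0 h1 m j
    have c : (2 * B) ^ j / (j.factorial : ℝ) ≤ Real.exp (2 * B) :=
      Real.pow_div_factorial_le_exp (2 * B) (by positivity) j
    have d : ((j : ℝ) + 1) ≤ 2 ^ j := by
      exact_mod_cast (Nat.lt_two_pow_self (n := j))
    have e : (j.factorial : ℝ) > 0 := by positivity
    calc ggq p m j ^ 2 ≤ (B ^ j / (j.factorial : ℝ)) ^ 2 := by gcongr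
      _ = (((j : ℝ) + 1) * B ^ j / (j.factorial : ℝ)) / B * (B ^ (j + 1) / (((j : ℝ) + 1) * (j.factorial : ℝ))) := by
        field_simp; ring
      _ ≤ ((2 : ℝ) ^ j * B ^ j / (j.factorial : ℝ)) / B * (B ^ (j + 1) / (((j : ℝ) + 1) * (j.factorial : ℝ))) := by
        gcongr
      _ ≤ Real.exp (2 * B) / B * (B ^ (j + 1) / (((j : ℝ) + 1) * (j.factorial : ℝ))) := by
        rw [← mul_pow]; gcongr
      _ = _ := by rw [Nat.factorial_succ]; push_cast; rfl

theorem ggq_sq (p B : ℝ) (hB0 : 0 < B) (h0 : 0 ≤ p) (h1 : p ≤ 1) (n m k : ℕ) (hm : m ≤ n) (hB : n * p ≤ B) :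
    ggq p m k ^ 2 ≤ Real.exp B * (B ^ k / (k.factorial : ℝ)) := by
  have a := ggq_le p B h0 h1 n m k hm hB
  have b := ggq_nonneg p h0 h1 m k
  have c : B ^ k / (k.factorial : ℝ) ≤ Real.exp B := Real.pow_div_factorial_le_exp B hB0.le k
  rw [sq]
  exact mul_le_mul (a.trans c) a b (Real.exp_pos _).le

theorem ggq'_nonneg (p : ℝ) (h0 : 0 ≤ p) (h1 : p ≤ 1) (m j : ℕ) : 0 ≤ ggq' p m j := by
  cases j with
  | zero => simp [ggq']
  | succ j => exact ggq_nonneg p h0 h1 m j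

theorem gg_offdiag (n : ℕ) (p B : ℝ) (hB0 : 0 < B) (h0 : 0 ≤ p) (h1 : p ≤ 1) (hB : n * p ≤ B)
    (v w : Fin n) (hvw : v ≠ w) (k : ℕ) :
    ∑ S : EdgeIdx n → Bool, ggW n p S * ((if degree n S v = k then 1 else 0) * (if degree n S w = k then 1 else 0)) -
      (∑ S : EdgeIdx n → Bool, ggW n p S * (if degree n S v = k then 1 else 0)) *
      (∑ S : EdgeIdx n → Bool, ggW n p S * (if degree n S w = k then 1 else 0)) ≤
    p * ((Real.exp B + Real.exp (2 * B) / B) * (B ^ k / (k.factorial : ℝ))) := by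
  rw [gg_pair' n p v w hvw, gg_single' n p v w hvw, gg_single' n p w v hvw.symm]
  have ha := gg_card_le n v w
  have hb := gg_card_le n w v
  generalize (Finset.univ.filter fun e : EdgeIdx n => v ∈ (e : Sym2 (Fin n)) ∧ w ∉ (e : Sym2 (Fin n))).card = a at *
  generalize (Finset.univ.filter fun e : EdgeIdx n => w ∈ (e : Sym2 (Fin n)) ∧ v ∉ (e : Sym2 (Fin n))).card = b at *
  have a1 := ggq_sq p B hB0 h0 h1 n a k ha hB
  have b1 := ggq_sq p B hB0 h0 h1 n b k hb hB
  have a2 := ggq'_sq p B hB0 h0 h1 n a k ha hB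
  have b2 := ggq'_sq p B hB0 h0 h1 n b k hb hB
  have a3 := ggq_nonneg p h0 h1 a k
  have b3 := ggq_nonneg p h0 h1 b k
  have a4 := ggq'_nonneg p h0 h1 a k
  have b4 := ggq'_nonneg p h0 h1 b k
  generalize ggq p a k = x at *
  generalize ggq p b k = y at *
  generalize ggq' p a k = x' at *
  generalize ggq' p b k = y' at *
  rw [add_mul (Real.exp B)]
  generalize Real.exp B * (B ^ k / (k.factorial : ℝ)) = K at *
  generalize Real.exp (2 * B) / B * (B ^ k / (k.factorial : ℝ)) = L at *
  have e1 : (x - x') * (y - y') ≤ K + L := by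
    nlinarith [sq_nonneg (x - y), sq_nonneg (x' - y'), mul_nonneg a3 b4, mul_nonneg a4 b3]
  have e2 : 0 ≤ K + L := by nlinarith
  have e3 : (1 - p) * ((x - x') * (y - y')) ≤ K + L := by
    nlinarith
  nlinarith [mul_le_mul_of_nonneg_left e3 h0]

theorem gg_cov_small (n : ℕ) (p B : ℝ) (hB0 : 0 < B) (h0 : 0 ≤ p) (h1 : p ≤ 1) (hB : n * p ≤ B) (k : ℕ) :
    covFn (gnpMeasure n p) (fun S => (degCount n k S : ℝ)) (fun S => (degCount n k S : ℝ)) ≤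
     (1 + B * (Real.exp B + Real.exp (2 * B) / B)) * n * B ^ k / (k.factorial : ℝ) := by
  unfold covFn
  rw [gg_integral, gg_integral]
  rw [ENNReal.toReal_ofReal h0, ENNReal.toReal_ofReal (by linarith : 0 ≤ 1 - p)]
  have hd : ∀ S, (degCount n k S : ℝ) = ∑ v : Fin n, (if degree n S v = k then (1 : ℝ) else 0) := by
    intro S; simp [degCount]
  set I : Fin n → (EdgeIdx n → Bool) → ℝ := fun v S => if degree n S v = k then (1 : ℝ) else 0 with hI
  set T : ℝ := B ^ k / (k.factorial : ℝ) with hT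
  have hT0 : 0 ≤ T := by positivity
  set D : ℝ := Real.exp B + Real.exp (2 * B) / B with hD
  have hD0 : 0 ≤ D := by positivity
  have s1 : ∑ S : EdgeIdx n → Bool, (∏ e, if S e then p else 1 - p) * ((degCount n k S : ℝ) * (degCount n k S : ℝ)) =
      ∑ v, ∑ w, ∑ S, ggW n p S * (I v S * I w S) := by
    simp_rw [hd, Finset.sum_mul_sum, Finset.mul_sum]
    rw [Finset.sum_comm]
    refine Finset.sum_congr rfl fun v _ => ?_
    rw [Finset.sum_comm]
    rfl
  have s2 : ∑ S : EdgeIdx n → Bool, (∏ e, if S e then p else 1 - p) * (degCount n k S : ℝ) =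
      ∑ v, ∑ S, ggW n p S * I v S := by
    simp_rw [hd, Finset.mul_sum]
    rw [Finset.sum_comm]
    rfl
  rw [s1, s2, Finset.sum_mul_sum, ← Finset.sum_sub_distrib]
  simp_rw [← Finset.sum_sub_distrib]
  have hb : ∀ v w : Fin n, (∑ S, ggW n p S * (I v S * I w S)) - (∑ S, ggW n p S * I v S) * (∑ S, ggW n p S * I w S)
      ≤ (if v = w then T else 0) + p * (D * T) := by
    intro v w
    by_cases hvw : v = w
    · subst hvw
      rw [if_pos rfl]
      have := gg_diag n p B h0 h1 hB v k
      have e : ∑ S, ggW n p S * (I v S * I v S) = ∑ S, ggW n p S * I v S := by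
        refine Finset.sum_congr rfl fun S _ => ?_
        simp only [hI]; split_ifs <;> simp
      rw [e]
      have : ∑ S, ggW n p S * I v S ≤ T := this
      have : 0 ≤ p * (D * T) := by positivity
      nlinarith [mul_self_nonneg (∑ S, ggW n p S * I v S)]
    · rw [if_neg hvw, zero_add]
      exact gg_offdiag n p B hB0 h0 h1 hB v w hvw k
  refine (Finset.sum_le_sum fun v _ => Finset.sum_le_sum fun w _ => hb v w).trans ?_
  simp only [Finset.sum_add_distrib, Finset.sum_ite_eq, Finset.mem_univ, if_true, Finset.sum_const,
    Finset.card_univ, Fintype.card_fin, nsmul_eq_mul]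
  rw [mul_div_assoc, ← hT]
  have : 0 ≤ n * (D * T) := by positivity
  nlinarith [mul_le_mul_of_nonneg_right hB this]

/-- The uniform variance bound `Var(N_k) = O(n B^k / k!)` for the number of vertices of
degree `k` in `G(n, λₙ/n)` with `λₙ ≤ B`. -/
theorem gnp_degree_count_variance_bound
    (B : ℝ) (hB : 0 < B) (lamn : ℕ → ℝ)
    (hpos : ∀ n, 0 < lamn n) (hle : ∀ n, lamn n ≤ B) :
    ∃ C : ℝ, ∀ n : ℕ, 1 ≤ n → ∀ k : ℕ,
      covFn (gnpMeasure n (lamn n / n))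
          (fun S => (degCount n k S : ℝ)) (fun S => (degCount n k S : ℝ)) ≤
        C * n * B ^ k / (k.factorial : ℝ) := by
  refine ⟨1 + B * (Real.exp B + Real.exp (2 * B) / B), fun n hn k => ?_⟩
  have hn' : (0 : ℝ) < n := by exact_mod_cast hn
  rcases lt_or_ge 1 (lamn n / n) with h | h
  · refine (gg_cov_large n _ h _).trans ?_
    positivity
  · refine gg_cov_small n _ B hB (div_nonneg (hpos n).le hn'.le) h ?_ k
    rw [mul_div_cancel₀ _ hn'.ne']
    exact hle n
end
end
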